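/- arXiv:2402.18477 — 6 statements merged into one kernel-verified Lean document; each statement's English description precedes it below -/
import Mathlib

section
/- Let G = (V, E) be a finite directed graph in which every directed cycle is a self-loop (a DAG with self-loops). Then the lifted graph G̃ = (Ṽ, Ẽ) is acyclic: there is no directed cycle in G̃ at all, i.e., no sequence of vertices w₀, w₁, …, w_k in Ṽ with k ≥ 1, w_k = w₀, and (w_l → w_{l+1}) ∈ Ẽ for all 0 ≤ l < k. (First claim of Proposition 1.) -/
open Sum

/-- `G = (V, E)` is a DAG with self-loops: every directed cycle stays at a single
vertex, i.e., is a self-loop. -/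
def IsDAGWithLoops {V : Type*} (E : V → V → Prop) : Prop :=
  ∀ (k : ℕ) (w : ℕ → V), 1 ≤ k → w k = w 0 →
    (∀ l < k, E (w l) (w (l + 1))) → ∀ l ≤ k, w l = w 0

/-- The edge relation of the lifted graph `G̃` on `Ṽ = V₀ ⊔ V₁` (`inl i = i₀`,
`inr i = i₁`): `i₀ → i₁` for every self-loop `i → i`, and `i₀ → j₀`, `i₁ → j₁`,
`i₀ → j₁` for every edge `i → j` with `i ≠ j`. -/
def liftedEdge {V : Type*} (E : V → V → Prop) : V ⊕ V → V ⊕ V → Prop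
  | .inl i, .inl j => i ≠ j ∧ E i j
  | .inl i, .inr j => (i = j ∧ E i i) ∨ (i ≠ j ∧ E i j)
  | .inr i, .inr j => i ≠ j ∧ E i j
  | .inr _, .inl _ => False

/-- The parents of `j`: `pa(j) = {i : (i → j) ∈ E}`. -/
def parents {V : Type*} (E : V → V → Prop) (j : V) : Set V := {i | E i j}


/-- first claim of Proposition 1. If every directed cycle of the
finite directed graph `G = (V, E)` is a self-loop, then the lifted graph `G̃` has
no directed cycle at all. -/
theorem lifted_graph_acyclic {V : Type*} [Fintype V] (E : V → V → Prop)
    (hG : IsDAGWithLoops E) :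
    ∀ (k : ℕ) (w : ℕ → V ⊕ V), 1 ≤ k → w k = w 0 →
      ¬ (∀ l < k, liftedEdge E (w l) (w (l + 1))) := by
  intro k w hk hw h
  have hp : ∀ a b : V ⊕ V, liftedEdge E a b → E (Sum.elim id id a) (Sum.elim id id b) := by
    rintro (a | a) (b | b) hab
    · exact hab.2
    · rcases hab with ⟨rfl, h1⟩ | ⟨_, h1⟩ <;> exact h1
    · exact hab.elim
    · exact hab.2
  have hc := hG k (fun l => Sum.elim id id (w l)) hk (by simp only [hw])
    (fun l hl => hp _ _ (h l hl))
  have hq : ∀ a b : V ⊕ V, liftedEdge E a b →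
      (Sum.elim id id a : V) = Sum.elim id id b → a.isLeft = true ∧ b.isLeft = false := by
    rintro (a | a) (b | b) hab he
    · exact absurd he hab.1
    · exact ⟨rfl, rfl⟩
    · exact hab.elim
    · exact absurd he hab.1
  have hs : ∀ l < k, (w l).isLeft = true ∧ (w (l + 1)).isLeft = false := fun l hl =>
    hq _ _ (h l hl) ((hc l hl.le).trans (hc (l + 1) hl).symm)
  have h0 := (hs 0 hk).1
  have h1 := (hs (k - 1) (by omega)).2
  rw [Nat.sub_add_cancel hk, hw, h0] at h1
  exact absurd h1 (by simp)
end

section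
/- Let G = (V, E) be a DAG with self-loops and G̃ its lifted graph. If i, j ∈ V are distinct and (i → j) ∉ E, then in G̃ the vertices i₀ and j₁ are d-separated given the conditioning set {j₀} ∪ {k₀ : k ∈ pa(j) \ {j}} ∪ {k₁ : k ∈ pa(j) \ {j}}. (Separating-set lemma for missing edges, proved in the completeness part of Theorem 1.) -/
open Sum

/-- `v 0, …, v m` is a path between `a` and `b` in the directed graph with edge
relation `F`: at least one edge (`m ≥ 1`, i.e. at least two vertices), endpoints
`a` and `b`, pairwise distinct vertices, and consecutive vertices joined by an
edge in one direction or the other. -/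
def IsPath {W : Type*} (F : W → W → Prop) (a b : W) (m : ℕ) (v : ℕ → W) : Prop :=
  1 ≤ m ∧ v 0 = a ∧ v m = b ∧
  (∀ l ≤ m, ∀ l' ≤ m, v l = v l' → l = l') ∧
  (∀ l < m, F (v l) (v (l + 1)) ∨ F (v (l + 1)) (v l))

/-- The interior vertex `v l` is a collider on the path `v`. -/
def IsCollider {W : Type*} (F : W → W → Prop) (v : ℕ → W) (l : ℕ) : Prop :=
  F (v (l - 1)) (v l) ∧ F (v (l + 1)) (v l)

/-- The path `v 0, …, v m` is blocked by the conditioning set `C`: it contains an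
interior non-collider vertex belonging to `C`, or an interior collider vertex
none of whose descendants (via `Relation.ReflTransGen F`) belongs to `C`. -/
def Blocked {W : Type*} (F : W → W → Prop) (C : Set W) (m : ℕ) (v : ℕ → W) : Prop :=
  ∃ l, 0 < l ∧ l < m ∧
    ((¬ IsCollider F v l ∧ v l ∈ C) ∨
      (IsCollider F v l ∧ ∀ u, Relation.ReflTransGen F (v l) u → u ∉ C))

/-- `a` and `b` are d-separated given `C`: every path between them is blocked. -/
def DSep {W : Type*} (F : W → W → Prop) (a b : W) (C : Set W) : Prop :=
  ∀ (m : ℕ) (v : ℕ → W), IsPath F a b m v → Blocked F C m v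

/-- The vertex sets `A` and `B` are d-separated given `C`. -/
def DSepSet {W : Type*} (F : W → W → Prop) (A B C : Set W) : Prop :=
  ∀ a ∈ A, ∀ b ∈ B, DSep F a b C


theorem aux_seq {V : Type*} (E : V → V → Prop) {a b : V} (h : Relation.ReflTransGen E a b) :
    ∃ (n : ℕ) (w : ℕ → V), w 0 = a ∧ w n = b ∧ ∀ l < n, E (w l) (w (l + 1)) := by
  induction h with
  | refl => exact ⟨0, fun _ => a, rfl, rfl, by simp⟩
  | @tail b c _ hbc ih =>
    obtain ⟨n, w, h0, hn, hw⟩ := ih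
    refine ⟨n + 1, fun l => if l ≤ n then w l else c, by simp [h0], by simp, ?_⟩
    intro l hl
    by_cases h : l < n
    · have h1 : l ≤ n := h.le
      have h2 : l + 1 ≤ n := h
      simpa [h1, h2] using hw l h
    · have h1 : l = n := by omega
      subst h1
      simpa [hn] using hbc

theorem aux_cycle {V : Type*} (E : V → V → Prop) (hG : IsDAGWithLoops E) {j k : V}
    (h : Relation.ReflTransGen E j k) (hk : E k j) : k = j := by
  obtain ⟨n, w, h0, hn, hw⟩ := aux_seq E h
  have h1 := hG (n + 1) (fun l => if l ≤ n then w l else j) (by omega) (by simp [h0]) (by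
    intro l hl
    by_cases h : l < n
    · have h1 : l ≤ n := h.le
      have h2 : l + 1 ≤ n := h
      simpa [h1, h2] using hw l h
    · have h1 : l = n := by omega
      subst h1
      simpa [hn] using hk) n (by omega)
  simpa [h0, hn] using h1

theorem aux_desc {V : Type*} (E : V → V → Prop) {j : V} {u : V ⊕ V}
    (h : Relation.ReflTransGen (liftedEdge E) (Sum.inr j) u) :
    ∃ k, u = Sum.inr k ∧ Relation.ReflTransGen E j k := by
  induction h with
  | refl => exact ⟨j, rfl, .refl⟩
  | @tail b c _ hbc ih =>
    obtain ⟨k, rfl, hk⟩ := ih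
    rcases c with c | c
    · exact hbc.elim
    · exact ⟨c, rfl, hk.tail hbc.2⟩

/-- separating-set lemma for missing edges, Theorem 1. If
`i ≠ j` and `(i → j) ∉ E`, then in the lifted graph `G̃` the vertices `i₀` and
`j₁` are d-separated given the conditioning set
`{j₀} ∪ {k₀ : k ∈ pa(j) \ {j}} ∪ {k₁ : k ∈ pa(j) \ {j}}`. -/
theorem dsep_of_not_edge {V : Type*} [Fintype V] (E : V → V → Prop)
    (hG : IsDAGWithLoops E) (i j : V) (hij : i ≠ j) (hE : ¬ E i j) :
    DSep (liftedEdge E) (Sum.inl i) (Sum.inr j)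
      ({Sum.inl j} ∪ Sum.inl '' (parents E j \ {j}) ∪ Sum.inr '' (parents E j \ {j})) := by
  classical
  rintro m v ⟨hm, h0, hmb, -, hadj⟩
  obtain ⟨m, rfl⟩ : ∃ n, m = n + 1 := ⟨m - 1, by omega⟩
  rcases hadj m (by omega) with hl | hl
  · have hm0 : 0 < m := by
      rcases Nat.eq_zero_or_pos m with rfl | h
      · rw [h0, hmb] at hl
        rcases hl with hl | hl
        · exact absurd hl.1 hij
        · exact absurd hl.2 hE
      · exact h
    refine ⟨m, hm0, by omega, Or.inl ?_⟩
    rw [hmb] at hl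
    unfold IsCollider
    rw [hmb]
    generalize v m = x at hl
    rcases x with k | k
    · refine ⟨fun h => h.2, ?_⟩
      rcases hl with ⟨rfl, _⟩ | hl
      · simp
      · exact Or.inl (Or.inr ⟨k, ⟨hl.2, hl.1⟩, rfl⟩)
    · refine ⟨fun h => ?_, Or.inr ⟨k, ⟨hl.2, hl.1⟩, rfl⟩⟩
      exact hl.1 (aux_cycle E hG (.single h.2.2) hl.2)
  · have hex : ∃ l, l < m + 1 ∧ Relation.ReflTransGen (liftedEdge E) (Sum.inr j) (v l) ∧
        liftedEdge E (v (l + 1)) (v l) :=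
      ⟨m, by omega, .single (hmb ▸ hl), hl⟩
    have hmin := fun l => Nat.find_min (H := hex) (m := l)
    obtain ⟨h1, h2, h3⟩ := Nat.find_spec hex
    generalize Nat.find hex = l at h1 h2 h3 hmin
    have hl0 : 0 < l := by
      rcases Nat.eq_zero_or_pos l with rfl | h
      · obtain ⟨k, hk, _⟩ := aux_desc E h2
        rw [h0] at hk
        cases hk
      · exact h
    obtain ⟨l, rfl⟩ : ∃ n, l = n + 1 := ⟨l - 1, by omega⟩
    refine ⟨l + 1, hl0, h1, Or.inr ⟨⟨?_, h3⟩, ?_⟩⟩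
    · rcases hadj l (by omega) with h | h
      · exact h
      · exact absurd ⟨by omega, h2.tail h, h⟩ (hmin l (by omega))
    · intro u hu hC
      obtain ⟨k, rfl, hk⟩ := aux_desc E (h2.trans hu)
      rcases hC with (hC | ⟨_, _, hC⟩) | ⟨k', hk', hC⟩
      · cases hC
      · cases hC
      · cases hC
        exact hk'.2 (aux_cycle E hG hk hk'.1)
end

section
/- Let G = (V, E) be a DAG with self-loops and G̃ its lifted graph. If i ∈ V and (i → i) ∉ E, then in G̃ the vertices i₀ and i₁ are d-separated given the conditioning set {k₀ : k ∈ pa(i) \ {i}} ∪ {k₁ : k ∈ pa(i) \ {i}}. (Separating-set lemma for missing self-loops, proved in the loop-removal part of Theorem 1.) -/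
open Sum

lemma transGen_seq {W : Type*} {R : W → W → Prop} {a b : W} (h : Relation.TransGen R a b) :
    ∃ (k : ℕ) (w : ℕ → W), 1 ≤ k ∧ w 0 = a ∧ w k = b ∧ ∀ l < k, R (w l) (w (l + 1)) := by
  induction h with
  | single h =>
    rename_i c
    refine ⟨1, fun n => if n = 0 then a else c, le_rfl, by simp, by simp, ?_⟩
    intro l hl
    obtain rfl : l = 0 := by omega
    simpa using h
  | tail _ h ih =>
    rename_i b c _
    obtain ⟨k, w, hk, h0, hb, hw⟩ := ih
    refine ⟨k + 1, fun n => if n ≤ k then w n else c, by omega, by simpa using h0, by simp, ?_⟩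
    intro l hl
    by_cases hlk : l < k
    · have h1 : l ≤ k := by omega
      have h2 : l + 1 ≤ k := by omega
      simpa [h1, h2] using hw l hlk
    · obtain rfl : l = k := by omega
      simpa [hb] using h

lemma no_cycle {V : Type*} {E : V → V → Prop} (hG : IsDAGWithLoops E) (i : V) :
    ¬ Relation.TransGen (fun a b => a ≠ b ∧ E a b) i i := by
  intro h
  obtain ⟨k, w, hk, h0, hb, hw⟩ := transGen_seq h
  have := hG k w hk (hb.trans h0.symm) (fun l hl => (hw l hl).2) 1 hk
  exact (hw 0 (by omega)).1 this.symm

lemma desc_inr {V : Type*} {E : V → V → Prop} {i : V} {u : V ⊕ V}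
    (h : Relation.TransGen (liftedEdge E) (Sum.inr i) u) :
    ∃ k, u = Sum.inr k ∧ Relation.TransGen (fun a b => a ≠ b ∧ E a b) i k := by
  induction h with
  | single h =>
    rename_i c
    cases c with
    | inl c => exact h.elim
    | inr c => exact ⟨c, rfl, .single h⟩
  | tail _ h ih =>
    rename_i b c _
    obtain ⟨k, rfl, hk⟩ := ih
    cases c with
    | inl c => exact h.elim
    | inr c => exact ⟨c, rfl, hk.tail h⟩

/-- separating-set lemma for missing self-loops, Theorem 1. If
`(i → i) ∉ E`, then in the lifted graph `G̃` the vertices `i₀` and `i₁` are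
d-separated given `{k₀ : k ∈ pa(i) \ {i}} ∪ {k₁ : k ∈ pa(i) \ {i}}`. -/
theorem dsep_of_not_loop {V : Type*} [Fintype V] (E : V → V → Prop)
    (hG : IsDAGWithLoops E) (i : V) (hE : ¬ E i i) :
    DSep (liftedEdge E) (Sum.inl i) (Sum.inr i)
      (Sum.inl '' (parents E i \ {i}) ∪ Sum.inr '' (parents E i \ {i})) := by
  rintro m v ⟨hm, h0, hvm, -, hadj⟩
  by_contra hB
  have key : ∀ n, n < m → liftedEdge E (v (m - n)) (v (m - n - 1)) ∧
      Relation.TransGen (liftedEdge E) (Sum.inr i) (v (m - n - 1)) := by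
    intro n
    induction n with
    | zero =>
      intro _
      simp only [Nat.sub_zero]
      have hlast := hadj (m - 1) (by omega)
      rw [Nat.sub_add_cancel hm, hvm] at hlast
      rw [hvm]
      rcases hlast with h | h
      · exfalso
        have hm1 : m - 1 ≠ 0 := by
          intro hz
          rw [hz, h0] at h
          rcases h with h | h
          · exact hE h.2
          · exact h.1 rfl
        apply hB
        refine ⟨m - 1, by omega, by omega, Or.inl ⟨?_, ?_⟩⟩
        · rintro ⟨-, h2⟩
          rw [Nat.sub_add_cancel hm, hvm] at h2
          generalize v (m - 1) = x at h h2
          cases x with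
          | inl k => exact h2
          | inr k =>
            obtain ⟨j, hj, hc⟩ := desc_inr ((Relation.TransGen.single h2).tail h)
            cases hj
            exact no_cycle hG i hc
        · generalize v (m - 1) = x at h
          cases x with
          | inl k =>
            rcases h with h | h
            · obtain ⟨rfl, h⟩ := h
              exact (hE h).elim
            · exact Or.inl ⟨k, ⟨h.2, h.1⟩, rfl⟩
          | inr k => exact Or.inr ⟨k, ⟨h.2, h.1⟩, rfl⟩
      · exact ⟨h, .single h⟩
    | succ n ih =>
      intro hn
      obtain ⟨h1, h2⟩ := ih (by omega)
      obtain ⟨l, hl⟩ : ∃ l, m = l + n + 2 := ⟨m - n - 2, by omega⟩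
      have e1 : m - n = l + 2 := by omega
      have e2 : m - (n + 1) = l + 1 := by omega
      rw [e1] at h1 h2
      rw [e2]
      simp only [Nat.add_sub_cancel, show l + 2 - 1 = l + 1 by omega] at h1 h2 ⊢
      rcases hadj l (by omega) with h | h
      · exfalso
        apply hB
        refine ⟨l + 1, by omega, by omega, Or.inr ⟨⟨h, h1⟩, ?_⟩⟩
        intro u hu hC
        obtain ⟨k, rfl, hk⟩ := desc_inr (h2.trans_left hu)
        rcases hC with ⟨k', _, hk'⟩ | ⟨k', ⟨ha, hb⟩, hk'⟩
        · cases hk'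
        · cases hk'
          exact no_cycle hG i (hk.tail ⟨hb, ha⟩)
      · exact ⟨h, h2.tail h⟩
  obtain ⟨-, h⟩ := key (m - 1) (by omega)
  rw [show m - (m - 1) - 1 = 0 by omega, h0] at h
  obtain ⟨k, hk, _⟩ := desc_inr h
  cases hk
end

section
/- Independence from non-ancestor initial conditions (the provable direction of Corollary 1, in abstract form): In the recursive σ-algebra system over the finite DAG G = (V, E), if i, j ∈ V and i ∉ An(j) (i is not an ancestor of j and i ≠ j), then 𝒳_j ⫫ ℐ_i, i.e., the σ-algebra of the j-th variable is (unconditionally) independent of the initial-condition σ-algebra of the vertex i. -/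
open ProbabilityTheory

open Sum

/-- `E` is acyclic: the directed graph has no directed cycle at all
(in particular no self-loops). -/
def IsAcyclicGraph {V : Type*} (E : V → V → Prop) : Prop :=
  ∀ (k : ℕ) (w : ℕ → V), 1 ≤ k → w k = w 0 →
    ¬ (∀ l < k, E (w l) (w (l + 1)))

/-- The ancestors of `j` (including `j` itself): vertices admitting a directed
path to `j`. -/
def ancestors {V : Type*} (E : V → V → Prop) (j : V) : Set V :=
  {k | Relation.ReflTransGen E k j}

/-- The non-descendants of `i`: vertices `j ≠ i` with no directed path from `i`
to `j`. -/
def nonDescendants {V : Type*} (E : V → V → Prop) (i : V) : Set V :=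
  {j | j ≠ i ∧ ¬ Relation.ReflTransGen E i j}


theorem walk_of_transGen_aux {V : Type*} {E : V → V → Prop} {a b : V}
    (h : Relation.TransGen E a b) :
    ∃ (k : ℕ) (w : ℕ → V), 1 ≤ k ∧ w 0 = a ∧ w k = b ∧ ∀ l < k, E (w l) (w (l + 1)) := by
  induction h with
  | @single b h =>
    refine ⟨1, fun l => if l = 0 then a else b, le_rfl, by simp, by simp, ?_⟩
    intro l hl
    obtain rfl : l = 0 := by omega
    simpa using h
  | @tail b c _ h ih =>
    obtain ⟨k, w, hk, h0, hwk, hw⟩ := ih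
    refine ⟨k + 1, fun l => if l ≤ k then w l else c, by omega, by simpa using h0, by simp, ?_⟩
    intro l hl
    rcases Nat.lt_or_ge l k with h1 | h1
    · have h2 : l ≤ k := h1.le
      have h3 : l + 1 ≤ k := h1
      simpa [h2, h3] using hw l h1
    · obtain rfl : l = k := by omega
      simpa [hwk] using h

theorem wellFounded_of_acyclic_aux {V : Type*} [Finite V] {E : V → V → Prop}
    (hE : IsAcyclicGraph E) : WellFounded E := by
  have : Std.Irrefl (Relation.TransGen E) := ⟨fun a h => by
    obtain ⟨k, w, hk, h0, hwk, hw⟩ := walk_of_transGen_aux h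
    exact hE k w hk (hwk.trans h0.symm) hw⟩
  have h := Finite.wellFounded_of_trans_of_irrefl (Relation.TransGen E)
  exact Subrelation.wf (fun h => Relation.TransGen.single h) h

/-- independence from non-ancestor initial conditions; the
provable direction of Corollary 1, abstract form. In the recursive σ-algebra
system over a finite DAG `G = (V, E)`, if `i` is not an ancestor of `j`
(equivalently `i ∉ An(j)`, which in particular forces `i ≠ j`), then `X j` is
unconditionally independent of the initial-condition σ-algebra `I i`. -/
theorem indep_initial_of_not_ancestor
    {Ω V : Type*} [Fintype V] {mΩ : MeasurableSpace Ω} [StandardBorelSpace Ω]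
    (μ : MeasureTheory.Measure Ω) [MeasureTheory.IsProbabilityMeasure μ]
    (E : V → V → Prop) (hE : IsAcyclicGraph E)
    (W I X : V → MeasurableSpace Ω)
    (hW : ∀ i, W i ≤ mΩ) (hI : ∀ i, I i ≤ mΩ) (hX : ∀ i, X i ≤ mΩ)
    (hIndep : iIndep (Sum.elim W I) μ)
    (hRec : ∀ i, X i ≤ W i ⊔ I i ⊔ ⨆ k ∈ parents E i, X k)
    (i j : V) (hij : i ∉ ancestors E j) :
    Indep (X j) (I i) μ := by
  have key : ∀ j, X j ≤ ⨆ s ∈ {s : V ⊕ V | Sum.elim id id s ∈ ancestors E j}, Sum.elim W I s := by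
    intro j
    induction j using (wellFounded_of_acyclic_aux hE).induction with
    | _ j ih =>
      refine (hRec j).trans (sup_le (sup_le ?_ ?_) (iSup₂_le fun k hk => (ih k hk).trans ?_))
      · exact le_iSup₂_of_le (Sum.inl j) Relation.ReflTransGen.refl le_rfl
      · exact le_iSup₂_of_le (Sum.inr j) Relation.ReflTransGen.refl le_rfl
      · exact biSup_mono fun s hs => Relation.ReflTransGen.tail hs hk
  have hle : ∀ s, Sum.elim W I s ≤ mΩ := by
    rintro (s | s)
    · exact hW s
    · exact hI s
  have hdis : Disjoint {s : V ⊕ V | Sum.elim id id s ∈ ancestors E j} {Sum.inr i} :=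
    Set.disjoint_singleton_right.2 hij
  have h := indep_iSup_of_disjoint hle hIndep hdis
  refine indep_of_indep_of_le_left (indep_of_indep_of_le_right h ?_) (key j)
  exact le_iSup₂_of_le (Sum.inr i) rfl le_rfl
end

section
/- Global Markov property for the symmetric independence criterion (abstract form of the conclusion of Appendix A.9): In the recursive σ-algebra system over the finite DAG G = (V, E), for all pairwise disjoint subsets A, B, C ⊆ V such that A and B are d-separated given C in G, one has (⋁_{a ∈ A} 𝒳_a) ⫫ (⋁_{b ∈ B} 𝒳_b) | (⋁_{c ∈ C} 𝒳_c). -/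
open ProbabilityTheory

open Sum

namespace GMP
open MeasureTheory

variable {Ω : Type*} {mΩ : MeasurableSpace Ω} {μ : Measure Ω} [IsProbabilityMeasure μ]

theorem sup_eq_generateFrom (ma mb : MeasurableSpace Ω) :
    ma ⊔ mb = MeasurableSpace.generateFrom
      {u | ∃ F G, MeasurableSet[ma] F ∧ MeasurableSet[mb] G ∧ u = F ∩ G} := by
  apply le_antisymm
  · apply sup_le
    · intro F hF
      exact MeasurableSpace.measurableSet_generateFrom
        ⟨F, Set.univ, hF, MeasurableSet.univ, by simp⟩
    · intro F hF
      exact MeasurableSpace.measurableSet_generateFrom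
        ⟨Set.univ, F, MeasurableSet.univ, hF, by simp⟩
  · apply MeasurableSpace.generateFrom_le
    rintro _ ⟨F, G, hF, hG, rfl⟩
    exact MeasurableSet.inter ((le_sup_left : ma ≤ ma ⊔ mb) _ hF)
      ((le_sup_right : mb ≤ ma ⊔ mb) _ hG)

theorem condExp_sup {ma mb : MeasurableSpace Ω} (ha : ma ≤ mΩ) (hb : mb ≤ mΩ) {f g : Ω → ℝ}
    (hf : Integrable f μ) (hg : Integrable g μ) (hgm : StronglyMeasurable[ma ⊔ mb] g)
    (h : ∀ F G, MeasurableSet[ma] F → MeasurableSet[mb] G →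
      ∫ x in F ∩ G, f x ∂μ = ∫ x in F ∩ G, g x ∂μ) :
    g =ᵐ[μ] μ[f | ma ⊔ mb] := by
  have hm : ma ⊔ mb ≤ mΩ := sup_le ha hb
  refine ae_eq_condExp_of_forall_setIntegral_eq hm hf (fun _ _ _ => hg.integrableOn) ?_
    hgm.aestronglyMeasurable
  intro s hs _
  symm
  have huniv : ∫ x, f x ∂μ = ∫ x, g x ∂μ := by
    simpa using h Set.univ Set.univ MeasurableSet.univ MeasurableSet.univ
  refine MeasurableSpace.induction_on_inter (m := ma ⊔ mb)
    (C := fun s _ => ∫ x in s, f x ∂μ = ∫ x in s, g x ∂μ)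
    (sup_eq_generateFrom ma mb) ?_ ?_ ?_ ?_ ?_ s hs
  · rintro _ ⟨F, G, hF, hG, rfl⟩ _ ⟨F', G', hF', hG', rfl⟩ _
    exact ⟨F ∩ F', G ∩ G', hF.inter hF', hG.inter hG', Set.inter_inter_inter_comm _ _ _ _⟩
  · simp
  · rintro _ ⟨F, G, hF, hG, rfl⟩
    exact h F G hF hG
  · intro t ht hC
    have h1 := integral_add_compl (hm t ht) hf
    have h2 := integral_add_compl (hm t ht) hg
    linarith
  · intro u hd hu hC
    rw [integral_iUnion (fun i => hm _ (hu i)) hd hf.integrableOn,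
      integral_iUnion (fun i => hm _ (hu i)) hd hg.integrableOn]
    exact tsum_congr hC

theorem setIntegral_indep {n k : MeasurableSpace Ω} (hn : n ≤ mΩ) (hk : k ≤ mΩ)
    (hi : Indep k n μ) {F G : Set Ω} (hF : MeasurableSet[k] F) (hG : MeasurableSet[n] G)
    {h : Ω → ℝ} (hh : StronglyMeasurable[k] h) (hint : Integrable h μ) :
    ∫ x in F ∩ G, h x ∂μ = μ.real G * ∫ x in F, h x ∂μ := by
  have h1 : μ[F.indicator h | n] =ᵐ[μ] fun _ => ∫ x, F.indicator h x ∂μ :=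
    condExp_indep_eq hk hn (hh.indicator hF) hi
  have h2 := setIntegral_condExp hn (hint.indicator (hk _ hF)) hG
  rw [setIntegral_congr_ae (g := fun _ => ∫ x, F.indicator h x ∂μ) (hn _ hG)
    (h1.mono fun x hx _ => hx), setIntegral_indicator (hk _ hF), integral_indicator (hk _ hF)] at h2
  rw [Set.inter_comm, ← h2]
  simp

theorem integrable_ind {s : Set Ω} (hs : MeasurableSet s) :
    Integrable (s.indicator fun _ => (1 : ℝ)) μ :=
  (integrable_const 1).indicator hs

theorem ind_mul_int {F : Set Ω} (hF : MeasurableSet F) {g : Ω → ℝ} (hg : Integrable g μ) :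
    Integrable ((F.indicator fun _ => (1 : ℝ)) * g) μ := by
  have : ((F.indicator fun _ => (1 : ℝ)) * g) = F.indicator g := by
    ext x; by_cases hx : x ∈ F <;> simp [hx]
  rw [this]; exact hg.indicator hF

theorem ind_inter (F s : Set Ω) : ((F ∩ s).indicator fun _ => (1 : ℝ)) =
    (F.indicator fun _ => (1 : ℝ)) * (s.indicator fun _ => (1 : ℝ)) := by
  ext x; by_cases hx : x ∈ F <;> by_cases hy : x ∈ s <;> simp [hx, hy]

variable [StandardBorelSpace Ω]

theorem condIndep_iff_condExp {m' m1 m2 : MeasurableSpace Ω} (h' : m' ≤ mΩ) (h1 : m1 ≤ mΩ)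
    (h2 : m2 ≤ mΩ) :
    CondIndep m' m1 m2 h' μ ↔ ∀ s, MeasurableSet[m2] s →
      (μ⟦s | m'⟧) =ᵐ[μ] (μ⟦s | m1 ⊔ m'⟧) := by
  rw [condIndep_iff m' m1 m2 h' h1 h2]
  constructor
  · intro h s hs
    have his := integrable_ind (μ := μ) (h2 _ hs)
    refine condExp_sup h1 h' his integrable_condExp
      (stronglyMeasurable_condExp.mono le_sup_right) ?_
    intro F G hF hG
    have hmul := h F s hF hs
    have hp : μ[(F.indicator fun _ => (1 : ℝ)) * (μ⟦s | m'⟧) | m'] =ᵐ[μ] (μ⟦F | m'⟧) * (μ⟦s | m'⟧) :=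
      condExp_mul_of_stronglyMeasurable_right stronglyMeasurable_condExp
        (ind_mul_int (h1 _ hF) integrable_condExp) (integrable_ind (h1 _ hF))
    have e1 := setIntegral_condExp h' (integrable_ind (μ := μ) ((h1 _ hF).inter (h2 _ hs))) hG
    have e2 := setIntegral_condExp h' (ind_mul_int (μ := μ) (h1 _ hF)
      (integrable_condExp (m := m') (f := s.indicator fun _ => (1 : ℝ)))) hG
    have e3 := setIntegral_congr_ae (μ := μ) (h' _ hG)
      ((hmul.trans hp.symm).mono fun x hx _ => hx)
    have key : ∀ g : Ω → ℝ, ∫ x in F ∩ G, g x ∂μ =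
        ∫ x in G, ((F.indicator fun _ => (1 : ℝ)) * g) x ∂μ := by
      intro g
      have : ((F.indicator fun _ => (1 : ℝ)) * g) = F.indicator g := by
        ext x; by_cases hx : x ∈ F <;> simp [hx]
      rw [this, setIntegral_indicator (h1 _ hF), Set.inter_comm]
    rw [key, key, ← e2, ← e3, e1, ind_inter]
  · intro h F s hF hs
    have hm : m1 ⊔ m' ≤ mΩ := sup_le h1 h'
    have his := integrable_ind (μ := μ) (h2 _ hs)
    rw [ind_inter]
    have hp : μ[(F.indicator fun _ => (1 : ℝ)) * (μ⟦s | m'⟧) | m'] =ᵐ[μ] (μ⟦F | m'⟧) * (μ⟦s | m'⟧) :=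
      condExp_mul_of_stronglyMeasurable_right stronglyMeasurable_condExp
        (ind_mul_int (h1 _ hF) integrable_condExp) (integrable_ind (h1 _ hF))
    have ht : μ[(F.indicator fun _ => (1 : ℝ)) * (s.indicator fun _ => (1 : ℝ)) | m1 ⊔ m'] =ᵐ[μ]
        (F.indicator fun _ => (1 : ℝ)) * (μ⟦s | m1 ⊔ m'⟧) :=
      condExp_mul_of_stronglyMeasurable_left
        (stronglyMeasurable_const.indicator ((le_sup_left : m1 ≤ m1 ⊔ m') _ hF))
        (ind_mul_int (h1 _ hF) his) his
    have hc := condExp_condExp_of_le (μ := μ)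
      (f := (F.indicator fun _ => (1 : ℝ)) * (s.indicator fun _ => (1 : ℝ)))
      (le_sup_right : m' ≤ m1 ⊔ m') hm
    refine hc.symm.trans (Filter.EventuallyEq.trans (condExp_congr_ae ?_) hp)
    refine ht.trans ?_
    filter_upwards [h s hs] with x hx
    simp [hx]

/-- Adding independent noise on the left, together with the conditioning. -/
theorem condIndep_noise {m' m1 m2 n : MeasurableSpace Ω} (h' : m' ≤ mΩ) (h1 : m1 ≤ mΩ)
    (h2 : m2 ≤ mΩ) (hn : n ≤ mΩ) (hi : Indep (m1 ⊔ m' ⊔ m2) n μ)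
    (h : CondIndep m' m1 m2 h' μ) : CondIndep m' (m1 ⊔ m' ⊔ n) m2 h' μ := by
  have hm : m1 ⊔ m' ≤ mΩ := sup_le h1 h'
  have hk : m1 ⊔ m' ⊔ m2 ≤ mΩ := sup_le hm h2
  rw [condIndep_iff_condExp h' h1 h2] at h
  rw [condIndep_iff_condExp h' (sup_le hm hn) h2]
  intro s hs
  have his := integrable_ind (μ := μ) (h2 _ hs)
  refine (h s hs).trans ?_
  have e : m1 ⊔ m' ⊔ n ⊔ m' = (m1 ⊔ m') ⊔ n :=
    sup_eq_left.2 (le_sup_right.trans le_sup_left)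
  rw [e]
  refine condExp_sup hm hn his integrable_condExp (stronglyMeasurable_condExp.mono le_sup_left) ?_
  intro F G hF hG
  rw [setIntegral_indep hn hk hi ((le_sup_left : m1 ⊔ m' ≤ m1 ⊔ m' ⊔ m2) _ hF) hG
      (stronglyMeasurable_const.indicator ((le_sup_right : m2 ≤ m1 ⊔ m' ⊔ m2) _ hs)) his,
    setIntegral_indep hn hk hi ((le_sup_left : m1 ⊔ m' ≤ m1 ⊔ m' ⊔ m2) _ hF) hG
      (stronglyMeasurable_condExp.mono le_sup_left) integrable_condExp,
    setIntegral_condExp hm his hF]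

theorem condIndep_weak_union {m' m'' m1 m2 : MeasurableSpace Ω} (h' : m' ≤ mΩ) (h'' : m'' ≤ mΩ)
    (h1 : m1 ≤ mΩ) (h2 : m2 ≤ mΩ) (hle : m' ≤ m'') (hle2 : m'' ≤ m1)
    (h : CondIndep m' m1 m2 h' μ) : CondIndep m'' m1 m2 h'' μ := by
  rw [condIndep_iff_condExp h' h1 h2] at h
  rw [condIndep_iff_condExp h'' h1 h2]
  intro s hs
  have h3 := h s hs
  have e1 : m1 ⊔ m' = m1 := sup_eq_left.2 (hle.trans hle2)
  have e2 : m1 ⊔ m'' = m1 := sup_eq_left.2 hle2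
  rw [e1] at h3
  rw [e2]
  have hc := condExp_condExp_of_le (μ := μ) (f := s.indicator fun _ => (1 : ℝ)) hle2 h1
  have h4 : μ[(μ⟦s | m'⟧) | m''] = (μ⟦s | m'⟧) :=
    condExp_of_stronglyMeasurable h'' (stronglyMeasurable_condExp.mono hle) integrable_condExp
  have h5 : μ[(μ⟦s | m'⟧) | m''] =ᵐ[μ] μ[(μ⟦s | m1⟧) | m''] := condExp_congr_ae h3
  rw [h4] at h5
  exact hc.symm.trans (h5.symm.trans h3)

end GMP

namespace GMP

section graph

variable {V : Type*} {E : V → V → Prop}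

theorem exists_walk_of_transGen {x y : V} (h : Relation.TransGen E x y) :
    ∃ (k : ℕ) (w : ℕ → V), 1 ≤ k ∧ w 0 = x ∧ w k = y ∧ ∀ l < k, E (w l) (w (l + 1)) := by
  induction h with
  | single h =>
    rename_i b
    refine ⟨1, fun l => if l = 0 then x else b, le_rfl, by simp, by simp, ?_⟩
    intro l hl
    have : l = 0 := by omega
    subst this
    simpa using h
  | tail _ h ih =>
    rename_i b c _
    obtain ⟨k, w, hk, h0, hkb, hw⟩ := ih
    refine ⟨k + 1, fun l => if l ≤ k then w l else c, by omega, by simpa using h0, by simp, ?_⟩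
    intro l hl
    rcases Nat.lt_or_ge l k with h1 | h1
    · have h2 : l + 1 ≤ k := h1
      simpa [h1.le, h2] using hw l h1
    · have : l = k := by omega
      subst this
      simpa [hkb] using h

theorem acyc (hE : IsAcyclicGraph E) (x : V) : ¬ Relation.TransGen E x x := by
  intro h
  obtain ⟨k, w, hk, h0, hkb, hw⟩ := exists_walk_of_transGen h
  exact hE k w hk (hkb.trans h0.symm) hw

theorem asymm' (hE : IsAcyclicGraph E) {x y : V} (h : E x y) : ¬ E y x := fun h' =>
  acyc hE x ((Relation.TransGen.single h).tail h')

/-- ancestor of the conditioning set -/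
def AnC (E : V → V → Prop) (C : Set V) (x : V) : Prop := ∃ u ∈ C, Relation.ReflTransGen E x u

/-- open walk -/
def Wk (E : V → V → Prop) (A C : Set V) (m : ℕ) (v : ℕ → V) (x : V) : Prop :=
  v 0 ∈ A ∧ v m = x ∧ (∀ l < m, E (v l) (v (l + 1)) ∨ E (v (l + 1)) (v l)) ∧
  ∀ l, 0 < l → l < m → (IsCollider E v l → AnC E C (v l)) ∧ (¬ IsCollider E v l → v l ∉ C)

variable {A B C : Set V}

theorem Wk.not_blocked {m : ℕ} {v : ℕ → V} {x : V} (h : Wk E A C m v x) : ¬ Blocked E C m v := by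
  rintro ⟨l, h0, hm, ⟨hc, hC⟩ | ⟨hc, hC⟩⟩
  · exact (h.2.2.2 l h0 hm).2 hc hC
  · obtain ⟨u, hu, hr⟩ := (h.2.2.2 l h0 hm).1 hc
    exact hC u hr hu

theorem Wk.extend {m : ℕ} {v : ℕ → V} {x y : V} (h : Wk E A C m v x) (hxy : E x y ∨ E y x)
    (hx : 0 < m → (E (v (m - 1)) x ∧ E y x → AnC E C x) ∧ (¬ (E (v (m - 1)) x ∧ E y x) → x ∉ C)) :
    ∃ w, Wk E A C (m + 1) w y ∧ w m = x := by
  obtain ⟨hA, hm, hadj, hint⟩ := h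
  have w1 : ∀ l ≤ m, (fun l => if l ≤ m then v l else y) l = v l := by
    intro l hl; simp [hl]
  have w2 : (fun l => if l ≤ m then v l else y) (m + 1) = y := by simp
  generalize (fun l => if l ≤ m then v l else y) = w at w1 w2
  refine ⟨w, ⟨by rw [w1 _ (by omega)]; exact hA, w2, ?_, ?_⟩, by rw [w1 _ le_rfl, hm]⟩
  · intro l hl
    rcases Nat.lt_or_ge l m with h1 | h1
    · rw [w1 _ h1.le, w1 _ h1]; exact hadj l h1
    · have : l = m := by omega
      subst this
      rw [w1 _ le_rfl, w2, hm]; exact hxy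
  · intro l h0 hl
    unfold IsCollider
    rcases Nat.lt_or_ge l m with h1 | h1
    · rw [w1 _ h1.le, w1 _ h1, w1 (l - 1) (by omega)]; exact hint l h0 h1
    · have : l = m := by omega
      subst this
      rw [w1 _ le_rfl, w2, hm, w1 (l - 1) (by omega)]; exact hx h0

theorem Wk.loop (hE : IsAcyclicGraph E) {m : ℕ} {v : ℕ → V} {x : V} (h : Wk E A C m v x)
    {i j : ℕ} (hij : i < j) (hj : j ≤ m) (hv : v i = v j) (hi : E (v i) (v (i + 1))) :
    AnC E C (v i) := by
  by_contra hcon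
  have key : ∀ k, i + k + 1 ≤ j → Relation.TransGen E (v i) (v (i + k + 1)) ∧
      E (v (i + k)) (v (i + k + 1)) := by
    intro k
    induction k with
    | zero => intro _; exact ⟨.single hi, hi⟩
    | succ k ih =>
      intro hk
      obtain ⟨h1, h2⟩ := ih (by omega)
      have hstep : E (v (i + (k + 1))) (v (i + (k + 1) + 1)) := by
        rcases h.2.2.1 (i + (k + 1)) (by omega) with h3 | h3
        · exact h3
        · exfalso
          apply hcon
          obtain ⟨u, hu, hr⟩ := (h.2.2.2 (i + (k + 1)) (by omega) (by omega)).1 ⟨h2, h3⟩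
          exact ⟨u, hu, h1.to_reflTransGen.trans hr⟩
      exact ⟨h1.tail hstep, hstep⟩
  have h1 := (key (j - i - 1) (by omega)).1
  have e : i + (j - i - 1) + 1 = j := by omega
  rw [e, ← hv] at h1
  exact acyc hE _ h1

theorem Wk.cut (hE : IsAcyclicGraph E) {m : ℕ} {v : ℕ → V} {x : V} (h : Wk E A C m v x)
    {i j : ℕ} (hij : i < j) (hj : j ≤ m) (hv : v i = v j) :
    ∃ w, Wk E A C (m - (j - i)) w x := by
  have hl := h.loop hE hij hj hv
  obtain ⟨hA, hm, hadj, hint⟩ := h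
  obtain ⟨d, rfl⟩ : ∃ d, j = i + d := ⟨j - i, by omega⟩
  have w1 : ∀ l ≤ i, (fun l => if l ≤ i then v l else v (l + d)) l = v l := by
    intro l hl; simp [hl]
  have w2 : ∀ l, i ≤ l → (fun l => if l ≤ i then v l else v (l + d)) l = v (l + d) := by
    intro l hl
    rcases hl.eq_or_lt with rfl | h1
    · simpa using hv
    · simp [h1]
  generalize (fun l => if l ≤ i then v l else v (l + d)) = w at w1 w2
  have ed : m - (i + d - i) = m - d := by omega
  rw [ed]
  refine ⟨w, by rw [w1 _ (by omega)]; exact hA, ?_, ?_, ?_⟩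
  · rw [w2 _ (by omega), ← hm]; congr 1; omega
  · intro l hl
    rcases Nat.lt_or_ge l i with h1 | h1
    · rw [w1 _ h1.le, w1 _ h1]; exact hadj l (by omega)
    · rw [w2 _ h1, w2 _ (by omega)]
      have := hadj (l + d) (by omega)
      rwa [show l + 1 + d = l + d + 1 by omega]
  · intro l h0 hlm
    unfold IsCollider
    rcases lt_trichotomy l i with h1 | rfl | h1
    · rw [w1 _ h1.le, w1 _ h1, w1 (l - 1) (by omega)]; exact hint l h0 (by omega)
    · rw [w1 (l - 1) (by omega), w2 (l + 1) (by omega), w1 l le_rfl,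
        show l + 1 + d = l + d + 1 by omega]
      constructor
      · rintro ⟨h3, h4⟩
        rcases hadj l (by omega) with h5 | h5
        · exact hl h5
        · exact (hint l h0 (by omega)).1 ⟨h3, h5⟩
      · intro hn
        by_cases h3 : E (v (l - 1)) (v l)
        · have h4 : ¬ E (v (l + d + 1)) (v l) := fun h4 => hn ⟨h3, h4⟩
          rw [hv] at h4 ⊢
          exact (hint (l + d) (by omega) (by omega)).2 fun h5 => h4 h5.2
        · exact (hint l h0 (by omega)).2 fun h5 => h3 h5.1
    · rw [w2 l h1.le, w2 (l + 1) (by omega), w2 (l - 1) (by omega),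
        show l + 1 + d = l + d + 1 by omega, show l - 1 + d = l + d - 1 by omega]
      exact hint (l + d) (by omega) (by omega)

theorem no_walk (hE : IsAcyclicGraph E) (hAB : Disjoint A B) (hsep : DSepSet E A B C) {b : V}
    (hb : b ∈ B) : ¬ ∃ m v, Wk E A C m v b := by
  classical
  intro hex
  obtain ⟨v, hv⟩ := Nat.find_spec hex
  have hmin := fun k => Nat.find_min hex (m := k)
  generalize Nat.find hex = m at hv hmin
  have hmpos : 1 ≤ m := by
    by_contra h0
    have : m = 0 := by omega
    subst this
    exact Set.disjoint_left.1 hAB hv.1 (hv.2.1 ▸ hb)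
  have hinj : ∀ i j, i < j → j ≤ m → v i ≠ v j := by
    intro i j hij hj he
    exact hmin (m - (j - i)) (by omega) (hv.cut hE hij hj he)
  refine hv.not_blocked (hsep (v 0) hv.1 b hb m v ⟨hmpos, rfl, hv.2.1, ?_, hv.2.2.1⟩)
  intro l hl l' hl' he
  rcases lt_trichotomy l l' with h | h | h
  · exact absurd he (hinj _ _ h hl')
  · exact h
  · exact absurd he.symm (hinj _ _ h hl)

/-- reached by an open walk -/
def Conn (E : V → V → Prop) (A C : Set V) (x : V) : Prop := ∃ m v, Wk E A C m v x

def ConnUp (E : V → V → Prop) (A C : Set V) (x : V) : Prop :=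
  ∃ m v, Wk E A C m v x ∧ (0 < m → E x (v (m - 1)))

def ConnDown (E : V → V → Prop) (A C : Set V) (x : V) : Prop :=
  ∃ m v, Wk E A C m v x ∧ 0 < m ∧ E (v (m - 1)) x

theorem Conn.up_or_down {x : V} (h : Conn E A C x) : ConnUp E A C x ∨ ConnDown E A C x := by
  obtain ⟨m, v, h⟩ := h
  rcases Nat.eq_zero_or_pos m with rfl | h0
  · exact Or.inl ⟨0, v, h, by simp⟩
  · have := h.2.2.1 (m - 1) (by omega)
    rw [show m - 1 + 1 = m by omega, h.2.1] at this
    rcases this with h1 | h1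
    · exact Or.inr ⟨m, v, h, h0, h1⟩
    · exact Or.inl ⟨m, v, h, fun _ => h1⟩

theorem Conn.down (hE : IsAcyclicGraph E) {x y : V} (h : Conn E A C x) (hx : x ∉ C) (hxy : E x y) :
    ConnDown E A C y := by
  obtain ⟨m, v, h⟩ := h
  obtain ⟨w, hw, hwm⟩ := h.extend (Or.inl hxy)
    fun _ => ⟨fun h => absurd h.2 (asymm' hE hxy), fun _ => hx⟩
  exact ⟨m + 1, w, hw, by omega, by simpa [hwm] using hxy⟩

theorem ConnDown.conn {x : V} (h : ConnDown E A C x) : Conn E A C x := by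
  obtain ⟨m, v, h, _⟩ := h
  exact ⟨m, v, h⟩

theorem ConnUp.conn {x : V} (h : ConnUp E A C x) : Conn E A C x := by
  obtain ⟨m, v, h, _⟩ := h
  exact ⟨m, v, h⟩

theorem ConnUp.up (hE : IsAcyclicGraph E) {x y : V} (h : ConnUp E A C x) (hx : x ∉ C)
    (hyx : E y x) : ConnUp E A C y := by
  obtain ⟨m, v, h, hu⟩ := h
  obtain ⟨w, hw, hwm⟩ := h.extend (Or.inr hyx)
    fun h0 => ⟨fun h => absurd h.1 (asymm' hE (hu h0)), fun _ => hx⟩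
  exact ⟨m + 1, w, hw, fun _ => by simpa [hwm] using hyx⟩

theorem ConnDown.up {x y : V} (h : ConnDown E A C x) (hx : AnC E C x)
    (hyx : E y x) : ConnUp E A C y := by
  obtain ⟨m, v, h, h0, hu⟩ := h
  obtain ⟨w, hw, hwm⟩ := h.extend (Or.inr hyx)
    fun h0 => ⟨fun _ => hx, fun h => absurd ⟨hu, hyx⟩ h⟩
  exact ⟨m + 1, w, hw, fun _ => by simpa [hwm] using hyx⟩

theorem not_mem_of_not_AnC {x : V} (h : ¬ AnC E C x) : x ∉ C := fun hx => h ⟨x, hx, .refl⟩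

theorem conn_desc (hE : IsAcyclicGraph E) {x t : V} (h : Conn E A C x) (hx : ¬ AnC E C x)
    (hxt : Relation.ReflTransGen E x t) : Conn E A C t := by
  induction hxt with
  | refl => exact h
  | tail h1 h2 ih =>
    refine (ih.down hE (fun hC => hx ⟨_, hC, h1⟩) h2).conn

theorem connUp_anc (hE : IsAcyclicGraph E) {x t : V} (ht : t ∈ A) (hx : ¬ AnC E C x)
    (hxt : Relation.ReflTransGen E x t) : ConnUp E A C x := by
  induction hxt using Relation.ReflTransGen.head_induction_on with
  | refl => exact ⟨0, fun _ => t, ⟨ht, rfl, by simp, by omega⟩, by simp⟩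
  | head h1 h2 ih =>
    have : ¬ AnC E C _ := fun ⟨u, hu, hr⟩ => hx ⟨u, hu, hr.head h1⟩
    exact (ih this).up hE (not_mem_of_not_AnC this) h1

theorem conn_up_all (hE : IsAcyclicGraph E) (hB : ∀ b ∈ B, ¬ Conn E A C b) {x y : V}
    (hxS : ∃ t ∈ A ∪ B ∪ C, Relation.ReflTransGen E x t)
    (h : Conn E A C x) (hx : x ∉ C) (hyx : E y x) : Conn E A C y := by
  rcases h.up_or_down with hu | hd
  · exact (hu.up hE hx hyx).conn
  · by_cases hC : AnC E C x
    · exact (hd.up hC hyx).conn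
    · obtain ⟨t, (ht | ht) | ht, hr⟩ := hxS
      · exact ((connUp_anc hE ht hC hr).up hE hx hyx).conn
      · exact absurd (conn_desc hE h hC hr) (hB t ht)
      · exact absurd ⟨t, ht, hr⟩ hC

/-- All non-conditioned members of a family have the same connection status. -/
theorem family_conn (hE : IsAcyclicGraph E) (hB : ∀ b ∈ B, ¬ Conn E A C b) {z x y : V}
    (hzS : ∃ t ∈ A ∪ B ∪ C, Relation.ReflTransGen E z t)
    (hx : x = z ∨ E x z) (hy : y = z ∨ E y z) (hxC : x ∉ C) (h : Conn E A C x) :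
    Conn E A C y := by
  rcases hx with rfl | hx
  · rcases hy with rfl | hy
    · exact h
    · exact conn_up_all hE hB hzS h hxC hy
  · have hd := h.down hE hxC hx
    rcases hy with rfl | hy
    · exact hd.conn
    · by_cases hC : AnC E C z
      · exact (hd.up hC hy).conn
      · exact conn_up_all hE hB hzS hd.conn (not_mem_of_not_AnC hC) hy

end graph

section prob

open MeasureTheory

variable {Ω V : Type*} {mΩ : MeasurableSpace Ω} [StandardBorelSpace Ω]
  {μ : Measure Ω} [IsProbabilityMeasure μ] {E : V → V → Prop} {W I X : V → MeasurableSpace Ω}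

theorem sup_le_noise [Finite V] (hE : IsAcyclicGraph E)
    (hRec : ∀ i, X i ≤ W i ⊔ I i ⊔ ⨆ k ∈ parents E i, X k) (T : Set V)
    (hT : ∀ v ∈ T, ∀ k, E k v → k ∈ T) : ∀ i ∈ T, X i ≤ ⨆ j ∈ T, (W j ⊔ I j) := by
  have : IsTrans V (Relation.TransGen E) := ⟨fun _ _ _ => Relation.TransGen.trans⟩
  have : Std.Irrefl (Relation.TransGen E) := ⟨acyc hE⟩
  have wf := Finite.wellFounded_of_trans_of_irrefl (Relation.TransGen E)
  intro i
  induction i using wf.induction with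
  | _ i ih =>
    intro hi
    refine (hRec i).trans (sup_le (le_iSup₂_of_le i hi le_rfl) (iSup₂_le fun k hk => ?_))
    exact ih k (.single hk) (hT i hi k hk)

theorem step (hW : ∀ i, W i ≤ mΩ) (hI : ∀ i, I i ≤ mΩ) (hX : ∀ i, X i ≤ mΩ)
    (hIndep : iIndep (Sum.elim W I) μ)
    (hRec : ∀ i, X i ≤ W i ⊔ I i ⊔ ⨆ k ∈ parents E i, X k) (T T' P Q C : Set V) (v : V)
    (hvT : v ∉ T') (hTT : T = insert v T') (hvQ : v ∉ Q)
    (hpa : ∀ k, E k v → k ∈ T') (hfam : ∀ k, E k v → k ∈ P ∪ C)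
    (hN : ∀ i ∈ T', X i ≤ ⨆ j ∈ T', (W j ⊔ I j))
    (h0 : (⨆ c ∈ C ∩ T', X c) ≤ mΩ) (h1 : (⨆ c ∈ C ∩ T, X c) ≤ mΩ)
    (ih : CondIndep (⨆ c ∈ C ∩ T', X c) (⨆ a ∈ P ∩ T', X a) (⨆ b ∈ Q ∩ T', X b) h0 μ) :
    CondIndep (⨆ c ∈ C ∩ T, X c) (⨆ a ∈ P ∩ T, X a) (⨆ b ∈ Q ∩ T, X b) h1 μ := by
  have hle : ∀ S : Set V, (⨆ i ∈ S, X i) ≤ mΩ := fun S => iSup₂_le fun i _ => hX i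
  have hQ : Q ∩ T = Q ∩ T' := by
    subst hTT
    ext x
    simp only [Set.mem_inter_iff, Set.mem_insert_iff]
    constructor
    · rintro ⟨h, rfl | h2⟩
      · exact absurd h hvQ
      · exact ⟨h, h2⟩
    · exact fun h => ⟨h.1, Or.inr h.2⟩
  rw [hQ]
  have hind : Indep (⨆ j ∈ T', (W j ⊔ I j)) (W v ⊔ I v) μ := by
    have h := indep_iSup_of_disjoint (m := Sum.elim W I) (μ := μ)
      (by rintro (i | i); exacts [hW i, hI i]) hIndep
      (S := {s | Sum.elim id id s ∈ T'}) (T := {s | Sum.elim id id s = v})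
      (Set.disjoint_left.2 fun s hs hs' => by
        have h2 : Sum.elim id id s = v := hs'
        have h3 : Sum.elim id id s ∈ T' := hs
        exact hvT (h2 ▸ h3))
    refine indep_of_indep_of_le_left (indep_of_indep_of_le_right h ?_) ?_
    · exact sup_le (le_iSup₂_of_le (f := fun i _ => Sum.elim W I i) (Sum.inl v) rfl le_rfl)
        (le_iSup₂_of_le (f := fun i _ => Sum.elim W I i) (Sum.inr v) rfl le_rfl)
    · exact iSup₂_le fun j hj => sup_le
        (le_iSup₂_of_le (f := fun i _ => Sum.elim W I i) (Sum.inl j) hj le_rfl)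
        (le_iSup₂_of_le (f := fun i _ => Sum.elim W I i) (Sum.inr j) hj le_rfl)
  have hn : W v ⊔ I v ≤ mΩ := sup_le (hW v) (hI v)
  have hind2 : Indep ((⨆ a ∈ P ∩ T', X a) ⊔ (⨆ c ∈ C ∩ T', X c) ⊔ (⨆ b ∈ Q ∩ T', X b))
      (W v ⊔ I v) μ := by
    refine indep_of_indep_of_le_left hind ?_
    exact sup_le (sup_le (iSup₂_le fun i hi => hN i hi.2) (iSup₂_le fun i hi => hN i hi.2))
      (iSup₂_le fun i hi => hN i hi.2)
  have hM := condIndep_noise h0 (hle _) (hle _) hn hind2 ih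
  have hP' : ∀ i ∈ P ∩ T', X i ≤
      (⨆ a ∈ P ∩ T', X a) ⊔ (⨆ c ∈ C ∩ T', X c) ⊔ (W v ⊔ I v) := fun i hi =>
    (le_iSup₂_of_le (f := fun i _ => X i) i hi le_rfl).trans (le_sup_left.trans le_sup_left)
  have hC' : ∀ i ∈ C ∩ T', X i ≤
      (⨆ a ∈ P ∩ T', X a) ⊔ (⨆ c ∈ C ∩ T', X c) ⊔ (W v ⊔ I v) := fun i hi =>
    (le_iSup₂_of_le (f := fun i _ => X i) i hi le_rfl).trans (le_sup_right.trans le_sup_left)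
  have hv : X v ≤ (⨆ a ∈ P ∩ T', X a) ⊔ (⨆ c ∈ C ∩ T', X c) ⊔ (W v ⊔ I v) := by
    refine (hRec v).trans (sup_le le_sup_right (iSup₂_le fun k hk => ?_))
    rcases hfam k hk with h | h
    · exact hP' k ⟨h, hpa k hk⟩
    · exact hC' k ⟨h, hpa k hk⟩
  have hM2 := condIndep_weak_union h0 h1 (sup_le (sup_le (hle _) (hle _)) hn) (hle _)
    (biSup_mono (by subst hTT; exact fun i hi => ⟨hi.1, Or.inr hi.2⟩))
    (iSup₂_le fun i hi => by
      subst hTT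
      rcases hi with ⟨hi, rfl | h2⟩
      · exact hv
      · exact hC' i ⟨hi, h2⟩) hM
  refine condIndep_of_condIndep_of_le_left hM2 (iSup₂_le fun i hi => ?_)
  subst hTT
  rcases hi with ⟨hi, rfl | h2⟩
  · exact hv
  · exact hP' i ⟨hi, h2⟩

theorem split_indep [Finite V] (hE : IsAcyclicGraph E)
    (hW : ∀ i, W i ≤ mΩ) (hI : ∀ i, I i ≤ mΩ) (hX : ∀ i, X i ≤ mΩ)
    (hIndep : iIndep (Sum.elim W I) μ)
    (hRec : ∀ i, X i ≤ W i ⊔ I i ⊔ ⨆ k ∈ parents E i, X k) (P Q C : Set V)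
    (hPQ : Disjoint P Q) (hPC : Disjoint P C) (hQC : Disjoint Q C) (T : Finset V)
    (hT : ∀ v ∈ T, ∀ k, E k v → k ∈ T)
    (hfam : ∀ v ∈ T, (∀ k, k = v ∨ E k v → k ∈ P ∪ C) ∨ (∀ k, k = v ∨ E k v → k ∈ Q ∪ C))
    (h0 : (⨆ c ∈ C ∩ ↑T, X c) ≤ mΩ) :
    CondIndep (⨆ c ∈ C ∩ ↑T, X c) (⨆ a ∈ P ∩ ↑T, X a) (⨆ b ∈ Q ∩ ↑T, X b) h0 μ := by
  classical
  induction T using Finset.strongInduction with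
  | H T ih =>
    rcases T.eq_empty_or_nonempty with rfl | hne
    · have : (⨆ a ∈ P ∩ ↑(∅ : Finset V), X a) = ⊥ := by simp
      rw [this]
      exact condIndep_bot_left _
    · have : IsTrans V (flip (Relation.TransGen E)) :=
        ⟨fun _ _ _ h1 h2 => Relation.TransGen.trans h2 h1⟩
      have : Std.Irrefl (flip (Relation.TransGen E)) := ⟨acyc hE⟩
      have wf := Finite.wellFounded_of_trans_of_irrefl (flip (Relation.TransGen E))
      obtain ⟨v, hvT, hv⟩ := wf.has_min (↑T : Set V) hne
      have hvE : ∀ w ∈ T, ¬ E v w := fun w hw h => hv w hw (.single h)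
      have hT' : ∀ w ∈ T.erase v, ∀ k, E k w → k ∈ T.erase v := by
        intro w hw k hk
        have hwT := Finset.mem_of_mem_erase hw
        refine Finset.mem_erase.2 ⟨?_, hT w hwT k hk⟩
        rintro rfl
        exact hvE w hwT hk
      have hpa : ∀ k, E k v → k ∈ (↑(T.erase v) : Set V) := by
        intro k hk
        refine Finset.mem_coe.2 (Finset.mem_erase.2 ⟨?_, hT v hvT k hk⟩)
        rintro rfl
        exact hvE _ hvT hk
      have hle : ∀ S : Set V, (⨆ i ∈ S, X i) ≤ mΩ := fun S => iSup₂_le fun i _ => hX i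
      have ih' := ih (T.erase v) (Finset.erase_ssubset hvT) hT'
        (fun w hw => hfam w (Finset.mem_of_mem_erase hw)) (hle _)
      have hN := sup_le_noise hE hRec (↑(T.erase v) : Set V) hT'
      have hins : (↑T : Set V) = insert v ↑(T.erase v) := by
        rw [← Finset.coe_insert, Finset.insert_erase hvT]
      have hvn : v ∉ (↑(T.erase v) : Set V) := by simp
      rcases hfam v hvT with h | h
      · refine step hW hI hX hIndep hRec _ _ P Q C v hvn hins ?_ hpa
          (fun k hk => h k (Or.inr hk)) hN (hle _) h0 ih'
        rcases h v (Or.inl rfl) with h | h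
        · exact Set.disjoint_left.1 hPQ h
        · exact Set.disjoint_right.1 hQC h
      · refine (step hW hI hX hIndep hRec _ _ Q P C v hvn hins ?_ hpa
          (fun k hk => h k (Or.inr hk)) hN (hle _) h0 ih'.symm).symm
        rcases h v (Or.inl rfl) with h | h
        · exact Set.disjoint_right.1 hPQ h
        · exact Set.disjoint_right.1 hPC h

end prob

end GMP

/-- global Markov property for the symmetric independence
criterion, Appendix A.9, abstract form. In the recursive σ-algebra system over
a finite DAG `G = (V, E)`, for all pairwise disjoint `A, B, C ⊆ V` such that
`A` and `B` are d-separated given `C` in `G`, the joins `⨆ a ∈ A, X a` and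
`⨆ b ∈ B, X b` are conditionally independent given `⨆ c ∈ C, X c`. -/
theorem global_markov_property
    {Ω V : Type*} [Fintype V] {mΩ : MeasurableSpace Ω} [StandardBorelSpace Ω]
    (μ : MeasureTheory.Measure Ω) [MeasureTheory.IsProbabilityMeasure μ]
    (E : V → V → Prop) (hE : IsAcyclicGraph E)
    (W I X : V → MeasurableSpace Ω)
    (hW : ∀ i, W i ≤ mΩ) (hI : ∀ i, I i ≤ mΩ) (hX : ∀ i, X i ≤ mΩ)
    (hIndep : iIndep (Sum.elim W I) μ)
    (hRec : ∀ i, X i ≤ W i ⊔ I i ⊔ ⨆ k ∈ parents E i, X k)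
    (A B C : Set V)
    (hAB : Disjoint A B) (hAC : Disjoint A C) (hBC : Disjoint B C)
    (hsep : DSepSet E A B C)
    (hCle : (⨆ c ∈ C, X c) ≤ mΩ) :
    CondIndep (⨆ c ∈ C, X c) (⨆ a ∈ A, X a) (⨆ b ∈ B, X b) hCle μ := by
  classical
  have hnb : ∀ b ∈ B, ¬ GMP.Conn E A C b := fun b hb => GMP.no_walk hE hAB hsep hb
  let S : Set V := {z | ∃ t ∈ A ∪ B ∪ C, Relation.ReflTransGen E z t}
  let P : Set V := {x | x ∉ C ∧ GMP.Conn E A C x}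
  let Q : Set V := {x | x ∉ C ∧ ¬ GMP.Conn E A C x}
  let T : Finset V := Finset.univ.filter (· ∈ S)
  have hTS : (↑T : Set V) = S := by ext x; simp [T]
  have hsub : A ∪ B ∪ C ⊆ S := fun t ht => ⟨t, ht, .refl⟩
  have hCT : C ∩ ↑T = C := by
    rw [hTS]; exact Set.inter_eq_left.2 (Set.subset_union_right.trans hsub)
  have key := GMP.split_indep (μ := μ) hE hW hI hX hIndep hRec P Q C
    (Set.disjoint_left.2 fun x hx hx' => hx'.2 hx.2)
    (Set.disjoint_left.2 fun x hx hx' => hx.1 hx')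
    (Set.disjoint_left.2 fun x hx hx' => hx.1 hx') T
    (by
      intro v hv k hk
      simp only [T, Finset.mem_filter, Finset.mem_univ, true_and] at hv ⊢
      obtain ⟨t, ht, hr⟩ := hv
      exact ⟨t, ht, hr.head hk⟩)
    (by
      intro v hv
      simp only [T, Finset.mem_filter, Finset.mem_univ, true_and] at hv
      by_cases h : ∃ x, (x = v ∨ E x v) ∧ x ∉ C ∧ GMP.Conn E A C x
      · obtain ⟨x, hx, hxC, hc⟩ := h
        left
        intro k hk
        by_cases hkC : k ∈ C
        · exact Or.inr hkC
        · exact Or.inl ⟨hkC, GMP.family_conn hE hnb hv hx hk hxC hc⟩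
      · right
        intro k hk
        by_cases hkC : k ∈ C
        · exact Or.inr hkC
        · exact Or.inl ⟨hkC, fun hc => h ⟨k, hk, hkC, hc⟩⟩)
    (iSup₂_le fun i _ => hX i)
  simp only [hCT] at key
  refine ProbabilityTheory.condIndep_of_condIndep_of_le_left
    (ProbabilityTheory.condIndep_of_condIndep_of_le_right key ?_) ?_
  · refine biSup_mono fun b hb => ⟨⟨Set.disjoint_left.1 hBC hb, hnb b hb⟩, ?_⟩
    rw [hTS]; exact hsub (Or.inl (Or.inr hb))
  · refine biSup_mono fun a ha => ⟨⟨Set.disjoint_left.1 hAC ha, ?_⟩, ?_⟩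
    · exact ⟨0, fun _ => a, ha, rfl, by simp, by omega⟩
    · rw [hTS]; exact hsub (Or.inl (Or.inl ha))
end

section
/- Markov property with respect to the lifted graph (Proposition 1, abstract structural form): Let G = (V, E) be a DAG with self-loops and G̃ = (Ṽ, Ẽ) its lifted graph, and consider the lifted recursive σ-algebra system (𝒩_v)_{v∈Ṽ}, (𝒴_v)_{v∈Ṽ}. Then for all pairwise disjoint subsets I, J, K ⊆ V: if the vertex sets {i₀ : i ∈ I} and {j₁ : j ∈ J} are d-separated in G̃ given {j₀ : j ∈ J} ∪ {k₀ : k ∈ K} ∪ {k₁ : k ∈ K}, then (⋁_{i∈I} 𝒴_{i₀}) ⫫ (⋁_{j∈J} 𝒴_{j₁}) | ((⋁_{j∈J} 𝒴_{j₀}) ⋁ (⋁_{k∈K} (𝒴_{k₀} ⋁ 𝒴_{k₁}))). That is, the future-extended h-local conditional independence relation satisfies the global Markov property with respect to d-separation in G̃. -/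
open ProbabilityTheory

open Sum

section ProbPart
open MeasureTheory

variable {Ω : Type*} {mΩ : MeasurableSpace Ω} {μ : Measure Ω} [IsProbabilityMeasure μ]

lemma lmp_pi {m n : MeasurableSpace Ω} (hm : m ≤ mΩ) (hn : n ≤ mΩ) {f g : Ω → ℝ}
    (hf : Integrable f μ) (hg : Integrable g μ) (hgm : StronglyMeasurable[m ⊔ n] g)
    (h : ∀ s t, MeasurableSet[m] s → MeasurableSet[n] t →
      ∫ x in s ∩ t, g x ∂μ = ∫ x in s ∩ t, f x ∂μ) :
    g =ᵐ[μ] μ[f | m ⊔ n] := by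
  have hmn : m ⊔ n ≤ mΩ := sup_le hm hn
  refine ae_eq_condExp_of_forall_setIntegral_eq hmn hf (fun s _ _ => hg.integrableOn) ?_
    hgm.aestronglyMeasurable
  intro s hs _
  let p : Set (Set Ω) := {u | ∃ s t, MeasurableSet[m] s ∧ MeasurableSet[n] t ∧ u = s ∩ t}
  have hgen : m ⊔ n = MeasurableSpace.generateFrom p := by
    apply le_antisymm
    · refine sup_le ?_ ?_
      · intro s hs
        exact MeasurableSpace.measurableSet_generateFrom
          ⟨s, Set.univ, hs, MeasurableSet.univ, by simp⟩
      · intro s hs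
        exact MeasurableSpace.measurableSet_generateFrom
          ⟨Set.univ, s, MeasurableSet.univ, hs, by simp⟩
    · refine MeasurableSpace.generateFrom_le ?_
      rintro _ ⟨s, t, hs, ht, rfl⟩
      exact MeasurableSet.inter ((le_sup_left : m ≤ m ⊔ n) _ hs) ((le_sup_right : n ≤ m ⊔ n) _ ht)
  have hpi : IsPiSystem p := by
    rintro _ ⟨s, t, hs, ht, rfl⟩ _ ⟨s', t', hs', ht', rfl⟩ _
    exact ⟨s ∩ s', t ∩ t', hs.inter hs', ht.inter ht', Set.inter_inter_inter_comm _ _ _ _⟩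
  have huniv : ∫ x, g x ∂μ = ∫ x, f x ∂μ := by
    simpa using h Set.univ Set.univ MeasurableSet.univ MeasurableSet.univ
  refine MeasurableSpace.induction_on_inter (m := m ⊔ n)
    (C := fun s _ => ∫ x in s, g x ∂μ = ∫ x in s, f x ∂μ) hgen hpi (by simp) ?_ ?_ ?_ s hs
  · rintro _ ⟨s, t, hs, ht, rfl⟩
    exact h s t hs ht
  · intro t ht ih
    have h1 := integral_add_compl (hmn _ ht) hg
    have h2 := integral_add_compl (hmn _ ht) hf
    linarith
  · intro F hd hF ih
    rw [integral_iUnion (fun i => hmn _ (hF i)) hd hg.integrableOn,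
      integral_iUnion (fun i => hmn _ (hF i)) hd hf.integrableOn]
    exact tsum_congr ih

/-- Conditional independence, asymmetric form. -/
def LmpCI (μ : Measure Ω) (A B C : MeasurableSpace Ω) : Prop :=
  ∀ b, MeasurableSet[B] b → (μ⟦b | A ⊔ C⟧) =ᵐ[μ] (μ⟦b | C⟧)

lemma lmp_ind_int {b : Set Ω} (hb : MeasurableSet b) :
    Integrable (b.indicator (fun _ => (1 : ℝ))) μ :=
  (integrable_const _).indicator hb

lemma LmpCI.prod {A B C : MeasurableSpace Ω} (hA : A ≤ mΩ) (hB : B ≤ mΩ) (hC : C ≤ mΩ)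
    (h : LmpCI μ A B C) {a b : Set Ω} (ha : MeasurableSet[A] a) (hb : MeasurableSet[B] b) :
    (μ⟦a ∩ b | C⟧) =ᵐ[μ] (μ⟦a | C⟧) * (μ⟦b | C⟧) := by
  have hAC : A ⊔ C ≤ mΩ := sup_le hA hC
  have e1 : (a ∩ b).indicator (fun _ => (1 : ℝ)) = a.indicator (b.indicator (fun _ => (1 : ℝ))) := by
    rw [Set.indicator_indicator]
  have e2 : a.indicator (μ⟦b | C⟧) = (a.indicator (fun _ => (1 : ℝ))) * (μ⟦b | C⟧) := by
    ext x; by_cases hx : x ∈ a <;> simp [hx]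
  have hib := lmp_ind_int (μ := μ) (hB _ hb)
  have hia := lmp_ind_int (μ := μ) (hA _ ha)
  have s1 : (μ⟦a ∩ b | A ⊔ C⟧) =ᵐ[μ] a.indicator (μ⟦b | C⟧) := by
    rw [e1]
    refine (condExp_indicator hib ((le_sup_left : A ≤ A ⊔ C) _ ha)).trans ?_
    filter_upwards [h b hb] with x hx
    by_cases hxa : x ∈ a <;> simp [hxa, hx]
  have s2 : (μ⟦a ∩ b | C⟧) =ᵐ[μ] μ[a.indicator (μ⟦b | C⟧) | C] :=
    (condExp_condExp_of_le (le_sup_right : C ≤ A ⊔ C) hAC).symm.trans (condExp_congr_ae s1)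
  refine s2.trans ?_
  have hi : Integrable (a.indicator (μ⟦b | C⟧)) μ := integrable_condExp.indicator (hA _ ha)
  rw [e2] at hi ⊢
  exact condExp_mul_of_stronglyMeasurable_right stronglyMeasurable_condExp hi hia

lemma LmpCI.symm {A B C : MeasurableSpace Ω} (hA : A ≤ mΩ) (hB : B ≤ mΩ) (hC : C ≤ mΩ)
    (h : LmpCI μ A B C) : LmpCI μ B A C := by
  intro a ha
  have hia := lmp_ind_int (μ := μ) (hA _ ha)
  refine (lmp_pi hB hC hia integrable_condExp
    (stronglyMeasurable_condExp.mono le_sup_right) ?_).symm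
  intro b c hb hc
  have hib := lmp_ind_int (μ := μ) (hB _ hb)
  have hiab := lmp_ind_int (μ := μ) ((hA _ ha).inter (hB _ hb))
  have e2 : b.indicator (μ⟦a | C⟧) = (b.indicator (fun _ => (1 : ℝ))) * (μ⟦a | C⟧) := by
    ext x; by_cases hx : x ∈ b <;> simp [hx]
  have hi : Integrable (b.indicator (μ⟦a | C⟧)) μ := integrable_condExp.indicator (hB _ hb)
  have s1 : μ[b.indicator (μ⟦a | C⟧) | C] =ᵐ[μ] (μ⟦a ∩ b | C⟧) := by
    refine Filter.EventuallyEq.trans ?_ (h.prod hA hB hC ha hb).symm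
    rw [mul_comm]
    rw [e2] at hi ⊢
    exact condExp_mul_of_stronglyMeasurable_right stronglyMeasurable_condExp hi hib
  have e3 : (a ∩ b).indicator (fun _ => (1 : ℝ)) = b.indicator (a.indicator (fun _ => (1 : ℝ))) := by
    rw [Set.indicator_indicator, Set.inter_comm]
  rw [Set.inter_comm b c, ← setIntegral_indicator (hB _ hb), ← setIntegral_indicator (hB _ hb),
    ← e3, ← setIntegral_condExp hC hi hc, ← setIntegral_condExp hC hiab hc]
  exact integral_congr_ae (ae_restrict_of_ae s1)

lemma lmp_indep {X m n : MeasurableSpace Ω} (hX : X ≤ mΩ) (hn : n ≤ mΩ) (hmX : m ≤ X)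
    (h : Indep X n μ) {b : Set Ω} (hb : MeasurableSet[X] b) :
    (μ⟦b | m ⊔ n⟧) =ᵐ[μ] (μ⟦b | m⟧) := by
  have hm := hmX.trans hX
  have hib := lmp_ind_int (μ := μ) (hX _ hb)
  refine (lmp_pi hm hn hib integrable_condExp
    (stronglyMeasurable_condExp.mono le_sup_left) ?_).symm
  intro s t hs ht
  have key : ∀ g : Ω → ℝ, StronglyMeasurable[X] g → Integrable g μ →
      ∫ x in t, g x ∂μ = ∫ x in t, (∫ y, g y ∂μ) ∂μ := by
    intro g hg hgi
    rw [← setIntegral_condExp hn hgi ht]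
    exact integral_congr_ae (ae_restrict_of_ae (condExp_indep_eq hX hn hg h))
  rw [Set.inter_comm s t, ← setIntegral_indicator (hm _ hs), ← setIntegral_indicator (hm _ hs),
    key _ ((stronglyMeasurable_condExp.mono hmX).indicator (hmX _ hs))
      (integrable_condExp.indicator (hm _ hs)),
    key _ ((stronglyMeasurable_const.indicator hb).indicator (hmX _ hs))
      (hib.indicator (hm _ hs)),
    integral_indicator (hm _ hs), integral_indicator (hm _ hs), setIntegral_condExp hm hib hs]

lemma LmpCI.reduce {A B C A1 C1 : MeasurableSpace Ω} (hA : A ≤ mΩ) (hC : C ≤ mΩ)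
    (h : LmpCI μ A B C) (hC1 : C ≤ C1) (hC1' : C1 ≤ A ⊔ C) (hA1 : A1 ≤ A ⊔ C) :
    LmpCI μ A1 B C1 := by
  intro b hb
  have key : ∀ D, C ≤ D → D ≤ A ⊔ C → (μ⟦b | D⟧) =ᵐ[μ] (μ⟦b | C⟧) := by
    intro D h1 h2
    have hAC : A ⊔ C ≤ mΩ := sup_le hA hC
    refine ((condExp_condExp_of_le h2 hAC).symm.trans (condExp_congr_ae (h b hb))).trans ?_
    rw [condExp_of_stronglyMeasurable (h2.trans hAC) (stronglyMeasurable_condExp.mono h1)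
      integrable_condExp]
  exact (key _ (hC1.trans le_sup_right) (sup_le hA1 hC1')).trans (key _ hC1 hC1').symm

lemma LmpCI.step {A B C N A1 C1 : MeasurableSpace Ω} (hA : A ≤ mΩ) (hB : B ≤ mΩ) (hC : C ≤ mΩ)
    (hN : N ≤ mΩ) (h : LmpCI μ A B C) (hi : Indep (A ⊔ B ⊔ C) N μ)
    (hC1 : C ≤ C1) (hC1' : C1 ≤ N ⊔ (A ⊔ C)) (hA1 : A1 ≤ N ⊔ (A ⊔ C)) :
    LmpCI μ A1 B C1 := by
  have e : N ⊔ (A ⊔ C) = A ⊔ N ⊔ C := by ac_rfl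
  rw [e] at hC1' hA1
  have h2 : LmpCI μ (A ⊔ N) B C := by
    intro b hb
    have e' : A ⊔ N ⊔ C = A ⊔ C ⊔ N := by ac_rfl
    rw [e']
    refine (lmp_indep (X := A ⊔ B ⊔ C) (sup_le (sup_le hA hB) hC) hN
      (sup_le (le_sup_left.trans le_sup_left) le_sup_right) hi
      ((le_sup_right.trans le_sup_left : B ≤ A ⊔ B ⊔ C) _ hb)).trans (h b hb)
  exact h2.reduce (sup_le hA hN) hC hC1 hC1' hA1

variable {W : Type*} [Finite W]

lemma lmp_ancestral (F : W → W → Prop) (hF : ∀ x, ¬ Relation.TransGen F x x)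
    (N Y : W → MeasurableSpace Ω) (hN : ∀ v, N v ≤ mΩ) (hY : ∀ v, Y v ≤ mΩ)
    (hInd : iIndep N μ) (hRec : ∀ v, Y v ≤ N v ⊔ ⨆ u ∈ {u | F u v}, Y u)
    (P Q C : Set W) (hPQ : Disjoint P Q) (hPC : Disjoint P C) (hQC : Disjoint Q C)
    (n : ℕ) : ∀ S : Set W, S.ncard = n → (∀ v ∈ S, ∀ u, F u v → u ∈ S) →
      (∀ v ∈ S, (v ∈ P ∪ C ∧ ∀ u, F u v → u ∈ P ∪ C) ∨ (v ∈ Q ∪ C ∧ ∀ u, F u v → u ∈ Q ∪ C)) →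
      (⨆ u ∈ S, Y u) ≤ (⨆ u ∈ S, N u) ∧
      LmpCI μ (⨆ u ∈ P ∩ S, Y u) (⨆ u ∈ Q ∩ S, Y u) (⨆ u ∈ C ∩ S, Y u) := by
  classical
  have hle : ∀ (T : Set W), (⨆ u ∈ T, Y u) ≤ mΩ := fun T => iSup₂_le fun u _ => hY u
  induction n with
  | zero =>
    intro S hS _ _
    rw [Set.ncard_eq_zero] at hS
    subst hS
    simp only [Set.mem_empty_iff_false, Set.inter_empty, iSup_false, iSup_bot, le_refl, true_and]
    intro b _
    simp
  | succ n ih =>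
    intro S hS hanc hfam
    have hne : S.Nonempty := by
      rw [← Set.ncard_pos]; omega
    have wf : WellFounded (fun a b => Relation.TransGen F b a) := by
      have : IsTrans W (fun a b => Relation.TransGen F b a) := ⟨fun a b c h1 h2 => h2.trans h1⟩
      have : Std.Irrefl (fun a b => Relation.TransGen F b a) := ⟨hF⟩
      exact Finite.wellFounded_of_trans_of_irrefl _
    obtain ⟨v, hvS, hmax⟩ := wf.has_min S hne
    have hmax' : ∀ w ∈ S, ¬ F v w := fun w hw h => hmax w hw (Relation.TransGen.single h)
    set S' := S \ {v} with hS'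
    have hsub : S' ⊆ S := Set.sdiff_subset
    have hanc' : ∀ w ∈ S', ∀ u, F u w → u ∈ S' := by
      intro w hw u hu
      refine ⟨hanc w hw.1 u hu, ?_⟩
      rintro rfl
      exact hmax' w hw.1 hu
    obtain ⟨ihN, ihC⟩ := ih S' (by rw [hS', Set.ncard_sdiff_singleton_of_mem hvS, hS]; rfl) hanc'
      (fun w hw => hfam w hw.1)
    have hpa : ∀ u, F u v → u ∈ S' := by
      intro u hu
      refine ⟨hanc v hvS u hu, ?_⟩
      rintro rfl
      exact hmax' _ hvS hu
    have hmono : ∀ {T T' : Set W}, T ⊆ T' → (⨆ u ∈ T, Y u) ≤ ⨆ u ∈ T', Y u :=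
      fun h => biSup_mono fun _ hu => h hu
    have hmonoN : ∀ {T T' : Set W}, T ⊆ T' → (⨆ u ∈ T, N u) ≤ ⨆ u ∈ T', N u :=
      fun h => biSup_mono fun _ hu => h hu
    refine ⟨?_, ?_⟩
    · refine iSup₂_le fun u hu => ?_
      by_cases huv : u = v
      · subst huv
        refine (hRec u).trans (sup_le (le_biSup N hu) ?_)
        exact (hmono (fun w hw => hpa w hw)).trans (ihN.trans (hmonoN hsub))
      · exact (le_biSup Y (show u ∈ S' from ⟨hu, huv⟩)).trans (ihN.trans (hmonoN hsub))
    · have hind : Indep (⨆ u ∈ S', Y u) (N v) μ := by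
        have := indep_iSup_of_disjoint hN hInd (S := S') (T := {v}) Set.disjoint_sdiff_left
        simp only [Set.mem_singleton_iff, iSup_iSup_eq_left] at this
        exact indep_of_indep_of_le_left this ihN
      have gen : ∀ P Q : Set W, Disjoint P Q → Disjoint Q C →
          LmpCI μ (⨆ u ∈ P ∩ S', Y u) (⨆ u ∈ Q ∩ S', Y u) (⨆ u ∈ C ∩ S', Y u) →
          (v ∈ P ∪ C ∧ ∀ u, F u v → u ∈ P ∪ C) →
          LmpCI μ (⨆ u ∈ P ∩ S, Y u) (⨆ u ∈ Q ∩ S, Y u) (⨆ u ∈ C ∩ S, Y u) := by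
        intro P Q hPQ hQC ihC hv
        have hvQ : v ∉ Q := by
          intro h
          rcases hv.1 with h' | h'
          · exact Set.disjoint_left.1 hPQ h' h
          · exact Set.disjoint_left.1 hQC h h'
        have eQ : Q ∩ S = Q ∩ S' := by
          ext u
          constructor
          · rintro ⟨h1, h2⟩
            exact ⟨h1, h2, fun h => hvQ (h ▸ h1)⟩
          · rintro ⟨h1, h2⟩
            exact ⟨h1, h2.1⟩
        rw [eQ]
        have hYv : Y v ≤ N v ⊔ ((⨆ u ∈ P ∩ S', Y u) ⊔ (⨆ u ∈ C ∩ S', Y u)) := by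
          refine (hRec v).trans (sup_le_sup_left ?_ _)
          refine iSup₂_le fun u hu => ?_
          rcases hv.2 u hu with h | h
          · exact (le_biSup Y (show u ∈ P ∩ S' from ⟨h, hpa u hu⟩)).trans le_sup_left
          · exact (le_biSup Y (show u ∈ C ∩ S' from ⟨h, hpa u hu⟩)).trans le_sup_right
        refine ihC.step (N := N v) (hle _) (hle _) (hle _) (hN v) ?_ ?_ ?_ ?_
        · refine indep_of_indep_of_le_left hind ?_
          exact sup_le (sup_le (hmono Set.inter_subset_right) (hmono Set.inter_subset_right))
            (hmono Set.inter_subset_right)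
        · exact hmono (Set.inter_subset_inter_right _ hsub)
        · refine iSup₂_le fun u hu => ?_
          by_cases huv : u = v
          · subst huv; exact hYv
          · exact (le_biSup Y (show u ∈ C ∩ S' from ⟨hu.1, hu.2, huv⟩)).trans
              (le_sup_right.trans le_sup_right)
        · refine iSup₂_le fun u hu => ?_
          by_cases huv : u = v
          · subst huv; exact hYv
          · exact (le_biSup Y (show u ∈ P ∩ S' from ⟨hu.1, hu.2, huv⟩)).trans
              (le_sup_left.trans le_sup_right)
      rcases hfam v hvS with hv | hv
      · exact gen P Q hPQ hQC ihC hv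
      · exact (gen Q P hPQ.symm hPC (ihC.symm (hle _) (hle _) (hle _)) hv).symm
          (hle _) (hle _) (hle _)

end ProbPart

section GraphPart

variable {W : Type*} {F : W → W → Prop}

/-- Unblocked walk. -/
def LmpWalk (F : W → W → Prop) (C : Set W) (m : ℕ) (v : ℕ → W) : Prop :=
  (∀ l < m, F (v l) (v (l + 1)) ∨ F (v (l + 1)) (v l)) ∧
  ∀ l, 0 < l → l < m → (IsCollider F v l → ∃ u ∈ C, Relation.ReflTransGen F (v l) u) ∧
    (¬ IsCollider F v l → v l ∉ C)

/-- Reachability along unblocked walks; the flag records whether the last edge points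
into the end vertex. -/
inductive LmpAct (F : W → W → Prop) (A C : Set W) : W → Bool → Prop
  | start (a) : a ∈ A → LmpAct F A C a false
  | fwd (x y d) : LmpAct F A C x d → x ∉ C → F x y → LmpAct F A C y true
  | bwd (x y) : LmpAct F A C x false → x ∉ C → F y x → LmpAct F A C y false
  | coll (x y) : LmpAct F A C x true → (∃ u ∈ C, Relation.ReflTransGen F x u) → F y x →
      LmpAct F A C y false

lemma lmp_asymm (hF : ∀ x, ¬ Relation.TransGen F x x) {x y : W} (h : F x y) : ¬ F y x :=
  fun h' => hF x ((Relation.TransGen.single h).tail h')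

lemma lmp_extend {C : Set W} {m : ℕ} {v : ℕ → W} (hv : LmpWalk F C m v) (y : W)
    (hadj : F (v m) y ∨ F y (v m))
    (hc : 0 < m → F (v (m - 1)) (v m) → F y (v m) → ∃ u ∈ C, Relation.ReflTransGen F (v m) u)
    (hn : 0 < m → ¬ (F (v (m - 1)) (v m) ∧ F y (v m)) → v m ∉ C) :
    LmpWalk F C (m + 1) (fun l => if l ≤ m then v l else y) := by
  refine ⟨?_, ?_⟩
  · intro l hl
    rcases Nat.lt_or_ge l m with h | h
    · simpa [h.le, Nat.succ_le_of_lt h] using hv.1 l h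
    · obtain rfl : l = m := by omega
      simpa using hadj
  · intro l h0 hl
    rcases Nat.lt_or_ge l m with h | h
    · have := hv.2 l h0 h
      have h1 : l - 1 ≤ m := by omega
      simpa [IsCollider, h.le, Nat.succ_le_of_lt h, h1] using this
    · obtain rfl : l = m := by omega
      have := hc h0
      have h2 := hn h0
      refine ⟨?_, ?_⟩
      · rintro ⟨a, b⟩
        simp at a b
        simpa using this a b
      · intro hcol
        simp [IsCollider] at hcol
        simp only [le_refl, if_true]
        exact h2 (by rintro ⟨a, b⟩; exact hcol a b)

lemma LmpAct.walk (hF : ∀ x, ¬ Relation.TransGen F x x) {A C : Set W}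
    {x : W} {d : Bool} (h : LmpAct F A C x d) :
    ∃ m v, LmpWalk F C m v ∧ v 0 ∈ A ∧ v m = x ∧
      (d = true → 0 < m ∧ F (v (m - 1)) x) ∧ (d = false → 0 < m → F x (v (m - 1))) := by
  induction h with
  | start a ha =>
    refine ⟨0, fun _ => a, ⟨by simp, by simp⟩, ha, rfl, by simp, by simp⟩
  | fwd x y d _ hx hxy ih =>
    obtain ⟨m, v, hw, h0, rfl, h1, h2⟩ := ih
    refine ⟨m + 1, _, lmp_extend hw y (Or.inl hxy) ?_ (fun _ _ => hx), by simpa, by simp, ?_, by simp⟩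
    · intro _ _ h; exact absurd h (lmp_asymm hF hxy)
    · simpa using hxy
  | bwd x y _ hx hxy ih =>
    obtain ⟨m, v, hw, h0, rfl, h1, h2⟩ := ih
    refine ⟨m + 1, _, lmp_extend hw y (Or.inr hxy) ?_ (fun _ _ => hx), by simpa, by simp, by simp, ?_⟩
    · intro hm h; exact absurd h (lmp_asymm hF (h2 rfl hm))
    · simpa using hxy
  | coll x y _ hx hxy ih =>
    obtain ⟨m, v, hw, h0, rfl, h1, h2⟩ := ih
    refine ⟨m + 1, _, lmp_extend hw y (Or.inr hxy) (fun _ _ _ => hx) ?_, by simpa, by simp, by simp, ?_⟩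
    · intro hm h; exact absurd ⟨(h1 rfl).2, hxy⟩ h
    · simpa using hxy

/-- following a walk that starts forward and returns backward, one meets a collider -/
lemma lmp_find_coll (hF : ∀ x, ¬ Relation.TransGen F x x) {C : Set W} {m : ℕ} {v : ℕ → W}
    (hv : LmpWalk F C m v) (n : ℕ) : ∀ i j, j - i = n → i < j → j ≤ m → F (v i) (v (i + 1)) →
      F (v j) (v (j - 1)) → ∃ u ∈ C, Relation.ReflTransGen F (v i) u := by
  induction n with
  | zero => intro i j h1 h2; omega
  | succ n ih =>
    intro i j h1 h2 h3 h4 h5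
    have hne : i + 1 ≠ j := by
      rintro rfl
      exact lmp_asymm hF h4 (by simpa using h5)
    by_cases hc : F (v (i + 2)) (v (i + 1))
    · obtain ⟨u, hu, hr⟩ := (hv.2 (i + 1) (by omega) (by omega)).1 ⟨by simpa using h4, hc⟩
      exact ⟨u, hu, Relation.ReflTransGen.head h4 hr⟩
    · have hf : F (v (i + 1)) (v (i + 2)) := (hv.1 (i + 1) (by omega)).resolve_right hc
      obtain ⟨u, hu, hr⟩ := ih (i + 1) j (by omega) (by omega) h3 hf h5
      exact ⟨u, hu, Relation.ReflTransGen.head h4 hr⟩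

lemma lmp_cut (hF : ∀ x, ¬ Relation.TransGen F x x) {C : Set W} {m : ℕ} {v : ℕ → W}
    (hv : LmpWalk F C m v) {i j : ℕ} (hij : i < j) (hjm : j ≤ m) (he : v i = v j) :
    ∃ w, LmpWalk F C (m - (j - i)) w ∧ w 0 = v 0 ∧ w (m - (j - i)) = v m := by
  obtain ⟨w, hw1, hw2⟩ : ∃ w : ℕ → W, (∀ l ≤ i, w l = v l) ∧ (∀ l, i ≤ l → w l = v (l + (j - i))) := by
    refine ⟨fun l => if l ≤ i then v l else v (l + (j - i)), fun l hl => by simp [hl], ?_⟩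
    intro l hl
    by_cases h : l ≤ i
    · obtain rfl : l = i := by omega
      have : l + (j - l) = j := by omega
      simp [this, he]
    · simp [h]
  have hji : i + (j - i) = j := by omega
  refine ⟨w, ⟨?_, ?_⟩, hw1 0 (by omega), ?_⟩
  · intro l hl
    rcases Nat.lt_or_ge l i with h | h
    · rw [hw1 l h.le, hw1 (l + 1) h]; exact hv.1 l (by omega)
    · rw [hw2 l h, hw2 (l + 1) (by omega), show l + 1 + (j - i) = l + (j - i) + 1 by omega]
      exact hv.1 _ (by omega)
  · intro l h0 hl
    rcases Nat.lt_trichotomy l i with h | h | h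
    · have := hv.2 l h0 (by omega)
      unfold IsCollider at this ⊢
      rw [hw1 l h.le, hw1 (l + 1) h, hw1 (l - 1) (by omega)]
      exact this
    · subst h
      have hl1 : w (l - 1) = v (l - 1) := hw1 _ (by omega)
      have hl2 : w l = v l := hw1 _ le_rfl
      have hl3 : w (l + 1) = v (j + 1) := by rw [hw2 _ (by omega)]; congr 1; omega
      have hi := hv.2 l h0 (by omega)
      have hj := hv.2 j (by omega) (by omega)
      unfold IsCollider at hi hj ⊢
      rw [hl1, hl2, hl3]
      rw [← he] at hj
      refine ⟨?_, ?_⟩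
      · rintro ⟨a, b⟩
        by_cases c1 : F (v (l + 1)) (v l)
        · exact hi.1 ⟨a, c1⟩
        by_cases c2 : F (v (j - 1)) (v l)
        · exact hj.1 ⟨c2, b⟩
        have d1 : F (v l) (v (l + 1)) := (hv.1 l (by omega)).resolve_right c1
        have d2 : F (v j) (v (j - 1)) := by
          have := hv.1 (j - 1) (by omega)
          rw [show j - 1 + 1 = j by omega, ← he] at this
          rw [← he]
          exact this.resolve_left c2
        exact lmp_find_coll hF hv _ l j rfl hij hjm d1 d2
      · intro hn
        by_cases c1 : F (v (l - 1)) (v l)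
        · exact hj.2 fun h => hn ⟨c1, h.2⟩
        · exact hi.2 fun h => c1 h.1
    · have := hv.2 (l + (j - i)) (by omega) (by omega)
      unfold IsCollider at this ⊢
      rw [hw2 l h.le, hw2 (l + 1) (by omega), hw2 (l - 1) (by omega),
        show l + 1 + (j - i) = l + (j - i) + 1 by omega,
        show l - 1 + (j - i) = l + (j - i) - 1 by omega]
      exact this
  · rw [hw2 _ (by omega)]; congr 1; omega

lemma lmp_no_act (hF : ∀ x, ¬ Relation.TransGen F x x) {A B C : Set W} (hAB : Disjoint A B)
    (hsep : DSepSet F A B C) {b : W} (hb : b ∈ B) (d : Bool) : ¬ LmpAct F A C b d := by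
  classical
  intro h
  obtain ⟨m, v, hw, h0, hm, -, -⟩ := h.walk hF
  have hex : ∃ m, ∃ v, LmpWalk F C m v ∧ v 0 ∈ A ∧ v m = b := ⟨m, v, hw, h0, hm⟩
  obtain ⟨v, hw, h0, hm⟩ := Nat.find_spec hex
  have hmin := fun k => Nat.find_min hex (m := k)
  generalize Nat.find hex = m at hw hm hmin
  have hinj : ∀ i j, i < j → j ≤ m → v i ≠ v j := by
    intro i j hij hj he
    obtain ⟨w, w1, w2, w3⟩ := lmp_cut hF hw hij hj he
    exact hmin (m - (j - i)) (by omega) ⟨w, w1, w2 ▸ h0, w3.trans hm⟩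
  have hm1 : 1 ≤ m := by
    rcases Nat.eq_zero_or_pos m with rfl | h
    · exact absurd (hm ▸ hb) (Set.disjoint_left.1 hAB h0)
    · exact h
  obtain ⟨l, l0, l1, hl⟩ := hsep _ h0 b hb m v ⟨hm1, rfl, hm, by
    intro l hl l' hl' e
    rcases Nat.lt_trichotomy l l' with h | h | h
    · exact absurd e (hinj _ _ h hl')
    · exact h
    · exact absurd e.symm (hinj _ _ h hl), hw.1⟩
  rcases hl with ⟨h1, h2⟩ | ⟨h1, h2⟩
  · exact (hw.2 l l0 l1).2 h1 h2
  · obtain ⟨u, hu, hr⟩ := (hw.2 l l0 l1).1 h1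
    exact h2 u hr hu

lemma lmp_families (hF : ∀ x, ¬ Relation.TransGen F x x) {A B C : Set W} (hAB : Disjoint A B)
    (hsep : DSepSet F A B C) (Z P : Set W)
    (hZ : Z = {x | ∃ u ∈ A ∪ B ∪ C, Relation.ReflTransGen F x u})
    (hP : P = {x | x ∉ C ∧ ∃ d, LmpAct F A C x d}) :
    ∀ v ∈ Z, (v ∈ P ∪ C ∧ ∀ u, F u v → u ∈ P ∪ C) ∨
      (v ∈ (P ∪ C)ᶜ ∪ C ∧ ∀ u, F u v → u ∈ (P ∪ C)ᶜ ∪ C) := by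
  classical
  subst hP
  -- upward closure from a vertex of `P`
  have up : ∀ v ∈ Z, ∀ d, LmpAct F A C v d → ∀ y, F y v → (v ∈ C → d = true) → LmpAct F A C y false := by
    intro v hv d hd y hy hvC
    by_cases hC : ∃ u ∈ C, Relation.ReflTransGen F v u
    · cases d with
      | true => exact .coll v y hd hC hy
      | false =>
        refine .bwd v y hd (fun h => ?_) hy
        simpa using hvC h
    · have hvn : v ∉ C := fun h => hC ⟨v, h, .refl⟩
      rw [hZ] at hv
      obtain ⟨u, hu, hr⟩ := hv
      rcases hu with (hu | hu) | hu
      · have : LmpAct F A C v false := by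
          clear hd hvC hvn hy
          induction hr using Relation.ReflTransGen.head_induction_on with
          | refl => exact .start _ hu
          | head h1 h2 ih =>
            have hC' : ¬ ∃ u ∈ C, Relation.ReflTransGen F _ u :=
              fun ⟨u, hu, hr⟩ => hC ⟨u, hu, Relation.ReflTransGen.head h1 hr⟩
            exact .bwd _ _ (ih hC') (fun h => hC' ⟨_, h, .refl⟩) h1
        exact .bwd v y this hvn hy
      · exfalso
        have : ∃ d, LmpAct F A C u d := by
          clear hvC hvn hy
          induction hr using Relation.ReflTransGen.head_induction_on generalizing d with
          | refl => exact ⟨_, hd⟩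
          | head h1 h2 ih =>
            have hC' : ¬ ∃ u ∈ C, Relation.ReflTransGen F _ u :=
              fun ⟨u, hu, hr⟩ => hC ⟨u, hu, Relation.ReflTransGen.head h1 hr⟩
            exact ih _ (.fwd _ _ _ hd (fun h => hC ⟨_, h, .refl⟩) h1) hC'
        obtain ⟨d', hd'⟩ := this
        exact lmp_no_act hF hAB hsep hu d' hd'
      · exact absurd ⟨u, hu, hr⟩ hC
  intro v hv
  by_cases hvP : v ∈ {x | x ∉ C ∧ ∃ d, LmpAct F A C x d}
  · left
    refine ⟨Or.inl hvP, fun u hu => ?_⟩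
    by_cases huC : u ∈ C
    · exact Or.inr huC
    · obtain ⟨h1, d, h2⟩ := hvP
      exact Or.inl ⟨huC, _, up v hv d h2 u hu (fun h => absurd h h1)⟩
  by_cases hx : ∃ x, F x v ∧ x ∈ {x | x ∉ C ∧ ∃ d, LmpAct F A C x d}
  · obtain ⟨x, hxv, hxC, d, hxd⟩ := hx
    have hvt : LmpAct F A C v true := .fwd x v d hxd hxC hxv
    have hvC : v ∈ C := by
      by_contra h
      exact hvP ⟨h, _, hvt⟩
    left
    refine ⟨Or.inr hvC, fun u hu => ?_⟩
    by_cases huC : u ∈ C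
    · exact Or.inr huC
    · exact Or.inl ⟨huC, _, up v hv true hvt u hu (fun _ => rfl)⟩
  · right
    refine ⟨?_, fun u hu => ?_⟩
    · by_cases hvC : v ∈ C
      · exact Or.inr hvC
      · exact Or.inl fun h => h.elim hvP hvC
    · by_cases huC : u ∈ C
      · exact Or.inr huC
      · exact Or.inl fun h => h.elim (fun h => hx ⟨u, hu, h⟩) huC

lemma lmp_seq {V : Type*} {E : V → V → Prop} {a b : V} (h : Relation.ReflTransGen E a b) :
    ∃ (k : ℕ) (w : ℕ → V), w 0 = a ∧ w k = b ∧ ∀ l < k, E (w l) (w (l + 1)) := by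
  induction h using Relation.ReflTransGen.head_induction_on with
  | refl => exact ⟨0, fun _ => b, rfl, rfl, by simp⟩
  | @head a c h1 h2 ih =>
    obtain ⟨k, w, h0, hk, hs⟩ := ih
    refine ⟨k + 1, fun l => Nat.casesOn l a w, rfl, hk, ?_⟩
    intro l hl
    cases l with
    | zero => simpa [h0] using h1
    | succ l => exact hs l (by omega)

lemma lmp_acyclic {V : Type*} {E : V → V → Prop} (hG : IsDAGWithLoops E) (x : V ⊕ V) :
    ¬ Relation.TransGen (liftedEdge E) x x := by
  intro h
  obtain ⟨y, hxy, hyx⟩ := Relation.TransGen.head'_iff.1 h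
  let p : V ⊕ V → V := Sum.elim id id
  have hlift : ∀ a b, liftedEdge E a b → E (p a) (p b) := by
    rintro (a | a) (b | b) h
    · exact h.2
    · rcases h with ⟨rfl, h⟩ | h
      · exact h
      · exact h.2
    · exact h.elim
    · exact h.2
  have hE : Relation.ReflTransGen E (p y) (p x) := Relation.ReflTransGen.lift p hlift _ _ hyx
  have hne : p x = p y := by
    obtain ⟨k, w, h0, hk, hs⟩ := lmp_seq hE
    have := hG (k + 1) (fun l => Nat.casesOn l (p x) w) (by omega) hk (by
      intro l hl
      cases l with
      | zero => simpa [h0] using hlift _ _ hxy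
      | succ l => exact hs l (by omega)) 1 (by omega)
    simpa [h0] using this.symm
  have hlev : ∀ z, Relation.ReflTransGen (liftedEdge E) y z → y.isRight → z.isRight := by
    intro z hz hy
    induction hz with
    | refl => exact hy
    | @tail b c _ hbc ih =>
      rcases b with b | b <;> rcases c with c | c <;> simp_all [liftedEdge]
  rcases x with x | x <;> rcases y with y | y
  · exact hxy.1 hne
  · simpa using hlev _ hyx rfl
  · exact hxy
  · exact hxy.1 hne

end GraphPart

/-- Markov property w.r.t. the lifted graph; Proposition 1,
abstract structural form. In the lifted recursive σ-algebra system over a DAG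
with self-loops `G = (V, E)` — with jointly independent noise σ-algebras
`N v`, `v ∈ Ṽ = V₀ ⊔ V₁`, and `Y v ≤ N v ⊔ ⨆ u ∈ pa_G̃(v), Y u` — for all
pairwise disjoint `I, J, K ⊆ V`: if `{i₀ : i ∈ I}` and `{j₁ : j ∈ J}` are
d-separated in `G̃` given `{j₀ : j ∈ J} ∪ {k₀, k₁ : k ∈ K}`, then
`⨆ i ∈ I, Y i₀` and `⨆ j ∈ J, Y j₁` are conditionally independent given
`(⨆ j ∈ J, Y j₀) ⊔ ⨆ k ∈ K, (Y k₀ ⊔ Y k₁)`. -/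
theorem lifted_markov_property
    {Ω V : Type*} [Fintype V] {mΩ : MeasurableSpace Ω} [StandardBorelSpace Ω]
    (μ : MeasureTheory.Measure Ω) [MeasureTheory.IsProbabilityMeasure μ]
    (E : V → V → Prop) (hG : IsDAGWithLoops E)
    (N Y : V ⊕ V → MeasurableSpace Ω)
    (hN : ∀ v, N v ≤ mΩ) (hY : ∀ v, Y v ≤ mΩ)
    (hIndep : iIndep N μ)
    (hRec : ∀ v, Y v ≤ N v ⊔ ⨆ u ∈ {u | liftedEdge E u v}, Y u)
    (I J K : Set V)
    (hIJ : Disjoint I J) (hIK : Disjoint I K) (hJK : Disjoint J K)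
    (hsep : DSepSet (liftedEdge E) (Sum.inl '' I) (Sum.inr '' J)
      (Sum.inl '' J ∪ Sum.inl '' K ∪ Sum.inr '' K))
    (hcond : ((⨆ j ∈ J, Y (Sum.inl j)) ⊔ ⨆ k ∈ K, (Y (Sum.inl k) ⊔ Y (Sum.inr k))) ≤ mΩ) :
    CondIndep ((⨆ j ∈ J, Y (Sum.inl j)) ⊔ ⨆ k ∈ K, (Y (Sum.inl k) ⊔ Y (Sum.inr k)))
      (⨆ i ∈ I, Y (Sum.inl i)) (⨆ j ∈ J, Y (Sum.inr j)) hcond μ := by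
  classical
  set F := liftedEdge E with hFdef
  have hF : ∀ x, ¬ Relation.TransGen F x x := lmp_acyclic hG
  set A : Set (V ⊕ V) := Sum.inl '' I with hA
  set B : Set (V ⊕ V) := Sum.inr '' J with hB
  set C : Set (V ⊕ V) := Sum.inl '' J ∪ Sum.inl '' K ∪ Sum.inr '' K with hC
  have hAB : Disjoint A B := by
    rw [Set.disjoint_left]
    rintro _ ⟨i, _, rfl⟩ ⟨j, _, h⟩
    cases h
  have hAC : ∀ a ∈ A, a ∉ C := by
    rintro _ ⟨i, hi, rfl⟩ ((⟨j, hj, h⟩ | ⟨j, hj, h⟩) | ⟨j, hj, h⟩)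
    · cases h; exact Set.disjoint_left.1 hIJ hi hj
    · cases h; exact Set.disjoint_left.1 hIK hi hj
    · cases h
  have hBC : ∀ b ∈ B, b ∉ C := by
    rintro _ ⟨i, hi, rfl⟩ ((⟨j, hj, h⟩ | ⟨j, hj, h⟩) | ⟨j, hj, h⟩)
    · cases h
    · cases h
    · cases h; exact Set.disjoint_left.1 hJK hi hj
  set Z : Set (V ⊕ V) := {x | ∃ u ∈ A ∪ B ∪ C, Relation.ReflTransGen F x u} with hZ
  set P : Set (V ⊕ V) := {x | x ∉ C ∧ ∃ d, LmpAct F A C x d} with hP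
  have hZsub : A ∪ B ∪ C ⊆ Z := fun x hx => ⟨x, hx, .refl⟩
  have hfam := lmp_families hF hAB hsep Z P hZ hP
  have hZanc : ∀ v ∈ Z, ∀ u, F u v → u ∈ Z := by
    rintro v ⟨w, hw, hr⟩ u hu
    exact ⟨w, hw, Relation.ReflTransGen.head hu hr⟩
  have hPC : Disjoint P C := Set.disjoint_left.2 fun x hx => hx.1
  have hQC : Disjoint (P ∪ C)ᶜ C := Set.disjoint_left.2 fun x hx hc => hx (Or.inr hc)
  have hPQ : Disjoint P (P ∪ C)ᶜ := Set.disjoint_left.2 fun x hx hc => hc (Or.inl hx)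
  have main := (lmp_ancestral (μ := μ) F hF N Y hN hY hIndep hRec P (P ∪ C)ᶜ C hPQ hPC hQC _ Z rfl
    hZanc hfam).2
  have hle : ∀ (T : Set (V ⊕ V)), (⨆ u ∈ T, Y u) ≤ mΩ := fun T => iSup₂_le fun u _ => hY u
  have eC : (⨆ u ∈ C ∩ Z, Y u) =
      (⨆ j ∈ J, Y (Sum.inl j)) ⊔ ⨆ k ∈ K, (Y (Sum.inl k) ⊔ Y (Sum.inr k)) := by
    rw [Set.inter_eq_left.2 (Set.subset_union_right.trans hZsub), hC, iSup_union, iSup_union,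
      iSup_image, iSup_image, iSup_image, sup_assoc]
    simp only [iSup_sup_eq]
  have lA : (⨆ i ∈ I, Y (Sum.inl i)) ≤ ⨆ u ∈ P ∩ Z, Y u := by
    refine iSup₂_le fun i hi => ?_
    have hiA : (Sum.inl i : V ⊕ V) ∈ A := ⟨i, hi, rfl⟩
    exact le_biSup Y (show (Sum.inl i : V ⊕ V) ∈ P ∩ Z from
      ⟨⟨hAC _ hiA, _, .start _ hiA⟩, hZsub (Or.inl (Or.inl hiA))⟩)
  have lB : (⨆ j ∈ J, Y (Sum.inr j)) ≤ ⨆ u ∈ (P ∪ C)ᶜ ∩ Z, Y u := by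
    refine iSup₂_le fun j hj => ?_
    have hjB : (Sum.inr j : V ⊕ V) ∈ B := ⟨j, hj, rfl⟩
    refine le_biSup Y (show (Sum.inr j : V ⊕ V) ∈ (P ∪ C)ᶜ ∩ Z from
      ⟨?_, hZsub (Or.inl (Or.inr hjB))⟩)
    rintro (⟨_, d, hd⟩ | h)
    · exact lmp_no_act hF hAB hsep hjB d hd
    · exact hBC _ hjB h
  rw [condIndep_iff _ _ _ _ (lA.trans (hle _)) (lB.trans (hle _))]
  intro s t hs ht
  have := main.prod (hle _) (hle _) (hle _) (lA _ hs) (lB _ ht)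
  rw [eC] at this
  exact this
end
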